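/- Let k > 1, 0 < δ < 1, and let λ, λ' be non-zero real numbers. There is a constant C = C(k,δ,λ,λ') > 0 such that for all X ≥ 2 and all R ≥ max(2/|λ|, 2/|λ'|): ∫_R^{∞} |S_2(λα)|⁴ α^{−2} dα ≤ C X (log X)² / R, and ∫_R^{∞} |S_k(λ'α)|² α^{−2} dα ≤ C X^{1/k} (log X)³ / R. -/

import Mathlib

open scoped Classical
open MeasureTheory

noncomputable section

/-- `e x = exp(2πix)` -/
def e (x : ℝ) : ℂ := Complex.exp (2 * Real.pi * Complex.I * x)

/-- The exponential sum `S_k(α)` over primes `p` with `δX ≤ p^k ≤ X`. -/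
def S (k δ X α : ℝ) : ℂ :=
  ∑ p ∈ (Finset.range (⌈X⌉₊ + 1)).filter
      (fun p : ℕ => p.Prime ∧ δ * X ≤ (p : ℝ) ^ k ∧ (p : ℝ) ^ k ≤ X),
    (Real.log p : ℂ) * e ((p : ℝ) ^ k * α)

/-- The exponential sum `U_k(α)` over naturals `n` with `δX ≤ n^k ≤ X`. -/
def U (k δ X α : ℝ) : ℂ :=
  ∑ n ∈ (Finset.range (⌈X⌉₊ + 1)).filter
      (fun n : ℕ => δ * X ≤ (n : ℝ) ^ k ∧ (n : ℝ) ^ k ≤ X),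
    e ((n : ℝ) ^ k * α)

/-- The exponential integral `T_k(α)`. -/
def T (k δ X α : ℝ) : ℂ :=
  ∫ t in (δ * X) ^ (1 / k)..(X ^ (1 / k)), e (α * t ^ k)

/-- Chebyshev theta function. -/
def theta (x : ℝ) : ℝ :=
  ∑ p ∈ (Finset.range (⌊x⌋₊ + 1)).filter Nat.Prime, Real.log p

/-- The generalized Selberg integral `𝒥_k(X,h)`. -/
def selbergJ (k X h : ℝ) : ℝ :=
  ∫ x in X..(2 * X),
    (theta ((x + h) ^ (1 / k)) - theta (x ^ (1 / k)) -
      ((x + h) ^ (1 / k) - x ^ (1 / k))) ^ 2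

/-- `ψ(m,z) = 1` iff every prime factor of `m` is at least `z`. -/
def psi (m : ℕ) (z : ℝ) : ℝ :=
  if ∀ p : ℕ, p.Prime → p ∣ m → z ≤ (p : ℝ) then 1 else 0

/-- The function `z(p)` of Harman–Kumchev. -/
def zfun (X : ℝ) (p : ℕ) : ℝ :=
  if (p : ℝ) < X ^ ((1 : ℝ) / 7) then X ^ ((5 : ℝ) / 28) * (p : ℝ) ^ (-(1 : ℝ) / 2)
  else if (p : ℝ) ≤ X ^ ((3 : ℝ) / 14) then (p : ℝ)
  else X ^ ((5 : ℝ) / 14) * (p : ℝ)⁻¹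

/-- The Harman–Kumchev sieve weight `ρ(m)`. -/
def rho (X : ℝ) (m : ℕ) : ℝ :=
  psi m (X ^ ((5 : ℝ) / 42)) -
    ∑ p ∈ (Finset.range (⌈X ^ ((1 : ℝ) / 4)⌉₊ + 1)).filter
        (fun p : ℕ => p.Prime ∧ X ^ ((5 : ℝ) / 42) ≤ (p : ℝ) ∧ (p : ℝ) < X ^ ((1 : ℝ) / 4) ∧ p ∣ m),
      psi (m / p) (zfun X p)

/-- The sieved exponential sum `S̃_2(α)`. -/
def Stilde (δ X α : ℝ) : ℂ :=
  ∑ m ∈ (Finset.range (⌈X⌉₊ + 1)).filter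
      (fun m : ℕ => δ * X ≤ (m : ℝ) ^ 2 ∧ (m : ℝ) ^ 2 ≤ X),
    (rho X m : ℂ) * e ((m : ℝ) ^ 2 * α)

/-- The Fejér-type kernel `K_η(α)`. -/
def Kf (η α : ℝ) : ℝ :=
  if α = 0 then η ^ 2 else (Real.sin (Real.pi * α * η) / (Real.pi * α)) ^ 2



theorem sum_inv_primes_dyadic_le (j : ℕ) (hj : 1 ≤ j) :
    ∑ p ∈ Nat.primesLE (2 ^ (j + 1)) \ Nat.primesLE (2 ^ j), (p : ℝ)⁻¹ ≤ 4 / j := by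
  set A := Nat.primesLE (2 ^ (j + 1)) \ Nat.primesLE (2 ^ j) with hA
  have hmem : ∀ p ∈ A, 2 ^ j < p := by
    intro p hp
    simp only [hA, Finset.mem_sdiff, Nat.mem_primesLE, not_and] at hp
    by_contra h
    exact hp.2 (by omega) hp.1.2
  have hj' : (0 : ℝ) < j := by exact_mod_cast hj
  have hlog : 0 < Real.log 2 := Real.log_pos (by norm_num)
  have hcard : (A.card : ℝ) * (j * Real.log 2) ≤ 2 * Real.log 2 * 2 ^ (j + 1) := by
    have h1 : (A.card : ℝ) * (j * Real.log 2) ≤ ∑ p ∈ A, Real.log p := by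
      rw [← nsmul_eq_mul]
      refine Finset.card_nsmul_le_sum _ _ _ fun p hp => ?_
      rw [← Real.log_pow]
      exact Real.log_le_log (by positivity) (by exact_mod_cast (hmem p hp).le)
    have h2 : ∑ p ∈ A, Real.log p ≤ Chebyshev.theta ((2 ^ (j + 1) : ℕ) : ℝ) := by
      rw [Chebyshev.theta_eq_sum_primesLE_log]
      refine Finset.sum_le_sum_of_subset_of_nonneg Finset.sdiff_subset fun p hp _ => ?_
      exact Real.log_natCast_nonneg p
    have h3 := Chebyshev.theta_le_log4_mul_x (x := ((2 ^ (j + 1) : ℕ) : ℝ)) (by positivity)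
    have h4 : Real.log 4 = 2 * Real.log 2 := by
      rw [show (4 : ℝ) = 2 ^ 2 by norm_num, Real.log_pow]; norm_num
    rw [h4] at h3
    push_cast at h3 h2
    linarith
  have hsum : ∑ p ∈ A, (p : ℝ)⁻¹ ≤ A.card * ((2 : ℝ) ^ j)⁻¹ := by
    rw [← nsmul_eq_mul]
    refine Finset.sum_le_card_nsmul _ _ _ fun p hp => ?_
    exact inv_anti₀ (by positivity) (by exact_mod_cast (hmem p hp).le)
  refine hsum.trans ?_
  rw [← div_eq_mul_inv, div_le_div_iff₀ (by positivity) hj']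
  have : (A.card : ℝ) * j ≤ 2 * 2 ^ (j + 1) := by
    refine le_of_mul_le_mul_right ?_ hlog
    linarith
  rw [pow_succ] at this
  linarith

/-- A weak form of Mertens' second theorem. -/
theorem sum_inv_primesLE_two_pow_le (J : ℕ) (hJ : 1 ≤ J) :
    ∑ p ∈ Nat.primesLE (2 ^ J), (p : ℝ)⁻¹ ≤ 5 + 4 * Real.log J := by
  have key : ∀ j : ℕ, ∑ p ∈ Nat.primesLE (2 ^ (j + 1)), (p : ℝ)⁻¹ ≤ 1 + 4 * (harmonic j : ℝ) := by
    intro j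
    induction j with
    | zero =>
      have : Nat.primesLE (2 ^ (0 + 1)) = {2} := by decide +kernel
      rw [this]
      norm_num
    | succ j ih =>
      have hsub : Nat.primesLE (2 ^ (j + 1)) ⊆ Nat.primesLE (2 ^ (j + 1 + 1)) :=
        Nat.primesLE_mono (Nat.pow_le_pow_right (by norm_num) (by omega))
      rw [← Finset.sum_sdiff hsub, harmonic_succ]
      have h := sum_inv_primes_dyadic_le (j + 1) (by omega)
      push_cast at h ⊢
      rw [div_eq_mul_inv] at h
      linarith
  obtain ⟨j, rfl⟩ : ∃ j, J = j + 1 := ⟨J - 1, by omega⟩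
  have h1 := key j
  have h2 := harmonic_le_one_add_log (j + 1)
  have h3 : (harmonic j : ℝ) ≤ harmonic (j + 1) := by
    rw [harmonic_succ]
    push_cast
    have : (0 : ℝ) ≤ ((j : ℝ) + 1)⁻¹ := by positivity
    linarith
  linarith

theorem sum_inv_primeFactors_le (D J : ℕ) (hD : D ≠ 0) (hJ : 1 ≤ J) (h : D ≤ 2 ^ (2 ^ J)) :
    ∑ q ∈ D.primeFactors, (q : ℝ)⁻¹ ≤ 6 + 4 * Real.log J := by
  have hcard : D.primeFactors.card ≤ 2 ^ J := by
    have h1 : 2 ^ D.primeFactors.card ≤ D := by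
      calc 2 ^ D.primeFactors.card ≤ ∏ p ∈ D.primeFactors, p :=
            Finset.pow_card_le_prod _ _ _ fun p hp => (Nat.prime_of_mem_primeFactors hp).two_le
        _ ≤ D := Nat.le_of_dvd (Nat.pos_of_ne_zero hD) (Nat.prod_primeFactors_dvd D)
    exact (Nat.pow_le_pow_iff_right (by norm_num)).1 (h1.trans h)
  rw [← Finset.sum_filter_add_sum_filter_not D.primeFactors (fun q => q ≤ 2 ^ J)]
  have h1 : ∑ q ∈ D.primeFactors with q ≤ 2 ^ J, (q : ℝ)⁻¹ ≤ 5 + 4 * Real.log J := by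
    refine le_trans ?_ (sum_inv_primesLE_two_pow_le J hJ)
    refine Finset.sum_le_sum_of_subset_of_nonneg ?_ fun p _ _ => by positivity
    intro p hp
    simp only [Finset.mem_filter] at hp
    exact Nat.mem_primesLE.2 ⟨hp.2, Nat.prime_of_mem_primeFactors hp.1⟩
  have h2 : ∑ q ∈ D.primeFactors with ¬ q ≤ 2 ^ J, (q : ℝ)⁻¹ ≤ 1 := by
    calc ∑ q ∈ D.primeFactors with ¬ q ≤ 2 ^ J, (q : ℝ)⁻¹
        ≤ (D.primeFactors.filter (fun q => ¬ q ≤ 2 ^ J)).card • ((2 : ℝ) ^ J)⁻¹ := by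
          refine Finset.sum_le_card_nsmul _ _ _ fun p hp => ?_
          simp only [Finset.mem_filter, not_le] at hp
          exact inv_anti₀ (by positivity) (by exact_mod_cast hp.2.le)
      _ ≤ ((2 : ℝ) ^ J) * ((2 : ℝ) ^ J)⁻¹ := by
          rw [nsmul_eq_mul]
          gcongr
          exact_mod_cast (Finset.card_filter_le _ _).trans hcard
      _ = 1 := mul_inv_cancel₀ (by positivity)
  linarith

theorem prod_one_sub_inv_primesBelow_le (n : ℕ) (hn : 2 ≤ n) :
    ∏ p ∈ n.primesBelow, (1 - (p : ℝ)⁻¹) ≤ (Real.log n)⁻¹ := by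
  let f : ℕ →* ℝ := 
    { toFun := fun m => (m : ℝ)⁻¹
      map_one' := by simp
      map_mul' := by intro a b; push_cast; exact mul_inv _ _ }
  obtain ⟨hs, hp⟩ := EulerProduct.summable_and_hasSum_smoothNumbers_prod_primesBelow_geometric
    (f := f) (fun {p} hp => by
      change ‖(p : ℝ)⁻¹‖ < 1
      rw [norm_inv, Real.norm_natCast]
      exact inv_lt_one_of_one_lt₀ (by exact_mod_cast hp.one_lt)) n
  have hlog : 0 < Real.log n := Real.log_pos (by exact_mod_cast hn)
  have hge : Real.log n ≤ ∏ p ∈ n.primesBelow, (1 - f p)⁻¹ := by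
    have h1 : ∑ m ∈ Finset.Icc 1 (n - 1), (m : ℝ)⁻¹ ≤ ∏ p ∈ n.primesBelow, (1 - f p)⁻¹ := by
      let s : Finset n.smoothNumbers := (Finset.Icc 1 (n - 1)).attach.image
        (fun m => ⟨m.1, Nat.mem_smoothNumbers_of_lt (by have := Finset.mem_Icc.1 m.2; omega)
          (by have := Finset.mem_Icc.1 m.2; omega)⟩)
      have h2 := sum_le_hasSum s (fun m _ => by simp [f]) hp
      refine le_trans (le_of_eq ?_) h2
      rw [Finset.sum_image]
      · rw [← Finset.sum_attach]
        rfl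
      · intro a _ b _ hab
        exact Subtype.ext (congrArg (fun x : n.smoothNumbers => (x : ℕ)) hab)
    have h3 := log_add_one_le_harmonic (n - 1)
    rw [harmonic_eq_sum_Icc] at h3
    push_cast at h3
    have : ((n - 1 + 1 : ℕ) : ℝ) = n := by congr 1; omega
    rw [← this]
    push_cast
    linarith
  rw [Finset.prod_inv_distrib] at hge
  have h0 : 0 < ∏ p ∈ n.primesBelow, (1 - f p) := by
    by_contra! h
    have := inv_nonpos.2 h
    linarith
  exact (le_inv_comm₀ hlog h0).1 hge


/-- Bonferroni's inequality, in Brun's form. -/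
theorem ite_empty_le_sum_powerset_card_le {ι : Type*} [DecidableEq ι] (B : Finset ι) {r : ℕ} (hr : Even r) :
    (if B = ∅ then (1 : ℝ) else 0) ≤ ∑ s ∈ B.powerset with s.card ≤ r, (-1 : ℝ) ^ s.card := by
  rw [Finset.sum_filter,
    Finset.sum_powerset_apply_card (fun m => if m ≤ r then (-1 : ℝ) ^ m else 0)]
  rcases Nat.eq_zero_or_pos B.card with h0 | hpos
  · simp [Finset.card_eq_zero.1 h0]
  · have hB : B ≠ ∅ := by rintro rfl; simp at hpos
    rw [if_neg hB]
    obtain ⟨n, hn⟩ : ∃ n, B.card = n + 1 := ⟨B.card - 1, by omega⟩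
    rw [hn]
    have h1 := Int.alternating_sum_range_choose_eq_choose (n := n) (m := r)
    have h2 : ∑ m ∈ Finset.range (n + 1 + 1), (n + 1).choose m • (if m ≤ r then (-1 : ℝ) ^ m else 0)
        = ∑ m ∈ Finset.range (r + 1), (-1 : ℝ) ^ m * (n + 1).choose m := by
      have h3 : ∀ m, (n + 1).choose m • (if m ≤ r then (-1 : ℝ) ^ m else 0)
          = if m ∈ Finset.range (r + 1) then (-1 : ℝ) ^ m * (n + 1).choose m else 0 := by
        intro m
        simp only [Finset.mem_range, Nat.lt_succ_iff, nsmul_eq_mul]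
        split_ifs <;> ring
      simp_rw [h3]
      rw [← Finset.sum_filter, Finset.filter_mem_eq_inter]
      refine Finset.sum_subset Finset.inter_subset_right fun m hm hm' => ?_
      have : n + 1 < m := by
        by_contra h
        exact hm' (Finset.mem_inter.2 ⟨Finset.mem_range.2 (by omega), hm⟩)
      simp [Nat.choose_eq_zero_of_lt this]
    rw [h2]
    have h4 : ∑ m ∈ Finset.range (r + 1), (-1 : ℝ) ^ m * (n + 1).choose m = (n.choose r : ℝ) := by
      have := congrArg (fun z : ℤ => (z : ℝ)) h1
      push_cast [hr.neg_one_pow] at this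
      simpa using this
    rw [h4]
    positivity

/-- The residues modulo `∏ q ∈ s, q` prescribed by residue sets `R q` modulo pairwise coprime `q`. -/
theorem exists_residues_prod (s : Finset ℕ) (R : ℕ → Finset ℕ) (hs0 : ∀ q ∈ s, 0 < q)
    (hs : (s : Set ℕ).Pairwise Nat.Coprime) (hR : ∀ q ∈ s, R q ⊆ Finset.range q) :
    ∃ V : Finset ℕ, V ⊆ Finset.range (∏ q ∈ s, q) ∧ V.card = ∏ q ∈ s, (R q).card ∧
      ∀ t, (∀ q ∈ s, t % q ∈ R q) ↔ t % (∏ q ∈ s, q) ∈ V := by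
  induction s using Finset.induction_on with
  | empty => exact ⟨{0}, by simp, by simp, fun t => by simp [Nat.mod_one]⟩
  | insert q s hq ih =>
    obtain ⟨V, hV1, hV2, hV3⟩ := ih (fun p hp => hs0 p (Finset.mem_insert_of_mem hp))
      (hs.mono (by simp)) (fun p hp => hR p (Finset.mem_insert_of_mem hp))
    set M := ∏ p ∈ s, p with hM
    have hq0 : 0 < q := hs0 q (Finset.mem_insert_self _ _)
    have hM0 : 0 < M := Finset.prod_pos fun p hp => hs0 p (Finset.mem_insert_of_mem hp)
    have hco : Nat.Coprime q M := by
      refine Nat.Coprime.prod_right fun p hp => ?_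
      exact hs (by simp) (by simp [hp]) (by rintro rfl; exact hq hp)
    have hRq := hR q (Finset.mem_insert_self _ _)
    refine ⟨(Finset.range (q * M)).filter (fun t => t % q ∈ R q ∧ t % M ∈ V), ?_, ?_, ?_⟩
    · rw [Finset.prod_insert hq]; exact Finset.filter_subset _ _
    · rw [Finset.prod_insert hq, ← hV2, ← Finset.card_product]
      refine Finset.card_bij (fun t _ => (t % q, t % M)) ?_ ?_ ?_
      · intro t ht
        simp only [Finset.mem_filter] at ht
        exact Finset.mem_product.2 ht.2
      · intro a ha b hb hab
        simp only [Finset.mem_filter, Finset.mem_range] at ha hb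
        simp only [Prod.mk.injEq] at hab
        have : a ≡ b [MOD q * M] := (Nat.modEq_and_modEq_iff_modEq_mul hco).1 hab
        exact Nat.ModEq.eq_of_lt_of_lt this ha.1 hb.1
      · rintro ⟨x, y⟩ hxy
        rw [Finset.mem_product] at hxy
        have hx := Finset.mem_range.1 (hRq hxy.1)
        have hy := Finset.mem_range.1 (hV1 hxy.2)
        have h1 := (Nat.chineseRemainder hco x y).2
        have e1 : (Nat.chineseRemainder hco x y : ℕ) % q = x := by
          rw [h1.1, Nat.mod_eq_of_lt hx]
        have e2 : (Nat.chineseRemainder hco x y : ℕ) % M = y := by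
          rw [h1.2, Nat.mod_eq_of_lt hy]
        refine ⟨Nat.chineseRemainder hco x y, ?_, ?_⟩
        · simp only [Finset.mem_filter, Finset.mem_range, e1, e2]
          exact ⟨Nat.chineseRemainder_lt_mul hco x y hq0.ne' hM0.ne', hxy⟩
        · simp only [e1, e2]
    · intro t
      rw [Finset.prod_insert hq, Finset.forall_mem_insert, hV3, ← hM]
      simp only [Finset.mem_filter, Finset.mem_range, Nat.mod_mul_right_mod,
        Nat.mod_mul_left_mod]
      exact ⟨fun h => ⟨Nat.mod_lt _ (by positivity), h⟩, fun h => h.2⟩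

theorem abs_card_range_residues_sub_le (s : Finset ℕ) (R : ℕ → Finset ℕ) (hs0 : ∀ q ∈ s, 0 < q)
    (hs : (s : Set ℕ).Pairwise Nat.Coprime) (hR : ∀ q ∈ s, R q ⊆ Finset.range q) (L : ℕ) :
    |(((Finset.range L).filter (fun t => ∀ q ∈ s, t % q ∈ R q)).card : ℝ) -
      L * ∏ q ∈ s, ((R q).card / q : ℝ)| ≤ ∏ q ∈ s, ((R q).card : ℝ) := by
  obtain ⟨V, hV1, hV2, hV3⟩ := exists_residues_prod s R hs0 hs hR
  set M := ∏ p ∈ s, p with hM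
  have hM0 : 0 < M := Finset.prod_pos hs0
  have hcard : ((Finset.range L).filter (fun t => ∀ q ∈ s, t % q ∈ R q)).card =
      ∑ v ∈ V, L.count (· ≡ v [MOD M]) := by
    have h1 : (Finset.range L).filter (fun t => ∀ q ∈ s, t % q ∈ R q) =
        V.biUnion (fun v => (Finset.range L).filter (fun t => t ≡ v [MOD M])) := by
      ext t
      simp only [Finset.mem_filter, Finset.mem_biUnion, hV3]
      constructor
      · rintro ⟨h, h'⟩
        exact ⟨_, h', h, (Nat.mod_modEq _ _).symm⟩
      · rintro ⟨v, hv, h, h'⟩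
        refine ⟨h, ?_⟩
        rw [h', Nat.mod_eq_of_lt (Finset.mem_range.1 (hV1 hv))]
        exact hv
    rw [h1, Finset.card_biUnion]
    · refine Finset.sum_congr rfl fun v _ => ?_
      rw [Nat.count_eq_card_filter_range]
    · intro a ha b hb hab
      rw [Function.onFun, Finset.disjoint_left]
      intro t ht ht'
      simp only [Finset.mem_filter] at ht ht'
      exact hab (Nat.ModEq.eq_of_lt_of_lt (ht.2.symm.trans ht'.2)
        (Finset.mem_range.1 (hV1 ha)) (Finset.mem_range.1 (hV1 hb)))
  have hone : ∀ v, |((L.count (· ≡ v [MOD M]) : ℕ) : ℝ) - L / M| ≤ 1 := by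
    intro v
    rw [Nat.count_modEq_card _ hM0]
    have hM' : (0 : ℝ) < M := by exact_mod_cast hM0
    have hdiv : (L : ℝ) / M = (L / M : ℕ) + ((L % M : ℕ) : ℝ) / M := by
      field_simp
      exact_mod_cast (Nat.div_add_mod L M).symm
    have hlt : ((L % M : ℕ) : ℝ) / M ≤ 1 := by
      rw [div_le_one hM']
      exact_mod_cast (Nat.mod_lt L hM0).le
    have hnn : 0 ≤ ((L % M : ℕ) : ℝ) / M := by positivity
    rw [hdiv, abs_le]
    split_ifs <;> push_cast <;> constructor <;> linarith
  have hprod : (L : ℝ) * ∏ q ∈ s, ((R q).card / q : ℝ) = ∑ v ∈ V, (L : ℝ) / M := by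
    rw [Finset.prod_div_distrib, Finset.sum_const, hV2, hM, nsmul_eq_mul]
    push_cast
    ring
  rw [hcard, hprod, Nat.cast_sum, ← Finset.sum_sub_distrib]
  refine (Finset.abs_sum_le_sum_abs _ _).trans ((Finset.sum_le_sum fun v _ => hone v).trans ?_)
  rw [Finset.sum_const, hV2]
  simp

theorem sum_powerset_prod_eq {ι : Type*} (P : Finset ι) (f : ι → ℝ) :
    ∑ s ∈ P.powerset, ∏ q ∈ s, f q = ∏ q ∈ P, (1 + f q) := (Finset.prod_one_add P).symm

/-- Brun's pure sieve, with `κ` residue classes removed for each prime. -/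
theorem brun_pure_sieve (P : Finset ℕ) (hP : ∀ q ∈ P, q.Prime) (R : ℕ → Finset ℕ) (κ : ℕ)
    (hκ : 1 ≤ κ) (hR : ∀ q ∈ P, R q ⊆ Finset.range q) (hRc : ∀ q ∈ P, (R q).card = κ) (L r : ℕ)
    (hr : Even r) (Z : ℕ) (hZ : 1 ≤ Z) (hPZ : P.card ≤ Z) :
    (((Finset.range L).filter (fun t => ∀ q ∈ P, t % q ∉ R q)).card : ℝ) ≤
      L * (∏ q ∈ P, (1 - κ * (q : ℝ)⁻¹) +
        ((2 : ℝ) ^ r)⁻¹ * Real.exp (2 * κ * ∑ q ∈ P, (q : ℝ)⁻¹)) +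
      (κ * Z : ℝ) ^ r * Real.exp 1 := by
  set g : ℕ → ℝ := fun q => κ * (q : ℝ)⁻¹ with hg
  have hg0 : ∀ q, 0 ≤ g q := fun q => by positivity
  set A : Finset ℕ → Finset ℕ := fun s => (Finset.range L).filter (fun t => ∀ q ∈ s, t % q ∈ R q)
    with hA
  have hκ' : (1 : ℝ) ≤ κ := by exact_mod_cast hκ
  have hZ' : (1 : ℝ) ≤ Z := by exact_mod_cast hZ
  set F := P.powerset.filter (fun s => s.card ≤ r) with hF
  have hAs : ∀ s ∈ F, |((A s).card : ℝ) - L * ∏ q ∈ s, g q| ≤ (κ : ℝ) ^ s.card := by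
    intro s hs
    have hsP : s ⊆ P := Finset.mem_powerset.1 (Finset.mem_filter.1 hs).1
    have h := abs_card_range_residues_sub_le s R (fun q hq => (hP q (hsP hq)).pos)
      (fun a ha b hb hab => (Nat.coprime_primes (hP a (hsP ha)) (hP b (hsP hb))).2 hab)
      (fun q hq => hR q (hsP hq)) L
    have e1 : ∏ q ∈ s, ((R q).card : ℝ) = (κ : ℝ) ^ s.card := by
      rw [Finset.prod_congr rfl (fun q hq => by rw [hRc q (hsP hq)]), Finset.prod_const]
    have e2 : ∏ q ∈ s, ((R q).card / q : ℝ) = ∏ q ∈ s, g q :=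
      Finset.prod_congr rfl (fun q hq => by rw [hRc q (hsP hq), hg, div_eq_mul_inv])
    rwa [e1, e2] at h
  -- inclusion-exclusion
  have h1 : (((Finset.range L).filter (fun t => ∀ q ∈ P, t % q ∉ R q)).card : ℝ) ≤
      ∑ s ∈ F, (-1 : ℝ) ^ s.card * (A s).card := by
    have e1 : ∀ s, ((A s).card : ℝ) =
        ∑ t ∈ Finset.range L, if ∀ q ∈ s, t % q ∈ R q then (1 : ℝ) else 0 := by
      intro s
      rw [hA, Finset.card_filter]
      push_cast
      rfl
    simp_rw [e1, Finset.mul_sum]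
    rw [Finset.sum_comm, Finset.card_filter]
    push_cast
    refine Finset.sum_le_sum fun t _ => ?_
    set B := P.filter (fun q => t % q ∈ R q) with hB
    have hBe : (∀ q ∈ P, t % q ∉ R q) ↔ B = ∅ := by
      rw [hB, Finset.filter_eq_empty_iff]
    have := ite_empty_le_sum_powerset_card_le B hr
    simp only [hBe]
    refine this.trans (le_of_eq ?_)
    simp_rw [mul_ite, mul_one, mul_zero]
    rw [← Finset.sum_filter]
    refine Finset.sum_congr ?_ fun _ _ => rfl
    ext s
    simp only [Finset.mem_filter, Finset.mem_powerset, hF, hB, Finset.subset_iff]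
    constructor
    · rintro ⟨h, h'⟩
      exact ⟨⟨fun q hq => (h hq).1, h'⟩, fun q hq => (h hq).2⟩
    · rintro ⟨⟨h, h'⟩, h''⟩
      exact ⟨fun q hq => ⟨h hq, h'' q hq⟩, h'⟩
  have h2 : ∑ s ∈ F, (-1 : ℝ) ^ s.card * (A s).card ≤
      L * ∑ s ∈ F, (-1 : ℝ) ^ s.card * ∏ q ∈ s, g q + ∑ s ∈ F, (κ : ℝ) ^ s.card := by
    rw [Finset.mul_sum, ← Finset.sum_add_distrib]
    refine Finset.sum_le_sum fun s hs => ?_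
    have h := abs_le.1 (hAs s hs)
    rcases neg_one_pow_eq_or ℝ s.card with h' | h' <;> rw [h'] <;> linarith [h.1, h.2]
  have h3 : ∑ s ∈ F, (-1 : ℝ) ^ s.card * ∏ q ∈ s, g q ≤ ∏ q ∈ P, (1 - g q) +
      ((2 : ℝ) ^ r)⁻¹ * Real.exp (2 * κ * ∑ q ∈ P, (q : ℝ)⁻¹) := by
    have e1 : ∏ q ∈ P, (1 - g q) = ∑ s ∈ P.powerset, (-1 : ℝ) ^ s.card * ∏ q ∈ s, g q := by
      have := sum_powerset_prod_eq P (fun q => - g q)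
      simp_rw [Finset.prod_neg] at this
      rw [this]
      simp [sub_eq_add_neg]
    have e2 : ∏ q ∈ P, (1 + 2 * g q) ≤ Real.exp (2 * κ * ∑ q ∈ P, (q : ℝ)⁻¹) := by
      rw [Finset.mul_sum, Real.exp_sum]
      refine Finset.prod_le_prod (fun q _ => by linarith [hg0 q]) fun q _ => ?_
      have := Real.add_one_le_exp (2 * κ * (q : ℝ)⁻¹)
      simp only [hg]
      linarith
    rw [e1, ← Finset.sum_filter_add_sum_filter_not P.powerset (fun s => s.card ≤ r)]
    have e3 : -∑ s ∈ P.powerset with ¬ s.card ≤ r, (-1 : ℝ) ^ s.card * ∏ q ∈ s, g q ≤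
        ((2 : ℝ) ^ r)⁻¹ * ∏ q ∈ P, (1 + 2 * g q) := by
      rw [← sum_powerset_prod_eq, Finset.mul_sum, ← Finset.sum_neg_distrib]
      refine le_trans ?_ (Finset.sum_le_sum_of_subset_of_nonneg
        (Finset.filter_subset (fun s => ¬ s.card ≤ r) P.powerset) fun s _ _ => ?_)
      · refine Finset.sum_le_sum fun s hs => ?_
        have hs' : r ≤ s.card := by
          have := (Finset.mem_filter.1 hs).2
          omega
        have hpg : 0 ≤ ∏ q ∈ s, g q := Finset.prod_nonneg fun q _ => hg0 q
        have hle : -((-1 : ℝ) ^ s.card * ∏ q ∈ s, g q) ≤ ∏ q ∈ s, g q := by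
          rcases neg_one_pow_eq_or ℝ s.card with h' | h' <;> rw [h'] <;> linarith
        refine hle.trans ?_
        rw [Finset.prod_mul_distrib (f := fun _ => (2 : ℝ)), Finset.prod_const, ← mul_assoc]
        refine le_mul_of_one_le_left hpg ?_
        rw [← div_eq_inv_mul, one_le_div (by positivity)]
        exact pow_le_pow_right₀ (by norm_num) hs'
      · exact mul_nonneg (by positivity) (Finset.prod_nonneg fun q _ => by linarith [hg0 q])
    have e4 : ((2 : ℝ) ^ r)⁻¹ * ∏ q ∈ P, (1 + 2 * g q) ≤
        ((2 : ℝ) ^ r)⁻¹ * Real.exp (2 * κ * ∑ q ∈ P, (q : ℝ)⁻¹) :=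
      mul_le_mul_of_nonneg_left e2 (by positivity)
    linarith
  have h4 : ∑ s ∈ F, (κ : ℝ) ^ s.card ≤ (κ * Z : ℝ) ^ r * Real.exp 1 := by
    have e1 : ∏ _q ∈ P, (1 + (Z : ℝ)⁻¹) ≤ Real.exp 1 := by
      calc ∏ _q ∈ P, (1 + (Z : ℝ)⁻¹) ≤ ∏ _q ∈ P, Real.exp ((Z : ℝ)⁻¹) := by
            refine Finset.prod_le_prod (fun q _ => by positivity) fun q _ => ?_
            linarith [Real.add_one_le_exp ((Z : ℝ)⁻¹)]
        _ = Real.exp (P.card * (Z : ℝ)⁻¹) := by rw [Finset.prod_const, ← Real.exp_nat_mul]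
        _ ≤ Real.exp 1 := by
            rw [Real.exp_le_exp, ← div_eq_mul_inv, div_le_one (by positivity)]
            exact_mod_cast hPZ
    refine le_trans ?_ (mul_le_mul_of_nonneg_left e1 (by positivity))
    rw [← sum_powerset_prod_eq, Finset.mul_sum]
    refine le_trans ?_ (Finset.sum_le_sum_of_subset_of_nonneg
        (Finset.filter_subset (fun s => s.card ≤ r) P.powerset) fun s _ _ => by positivity)
    refine Finset.sum_le_sum fun s hs => ?_
    have hs' : s.card ≤ r := (Finset.mem_filter.1 hs).2
    rw [Finset.prod_const]
    calc (κ : ℝ) ^ s.card = (κ * Z : ℝ) ^ s.card * ((Z : ℝ)⁻¹) ^ s.card := by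
          rw [← mul_pow, mul_assoc, mul_inv_cancel₀ (by positivity), mul_one]
      _ ≤ (κ * Z : ℝ) ^ r * ((Z : ℝ)⁻¹) ^ s.card := by
          gcongr
          nlinarith
  have h5 := mul_le_mul_of_nonneg_left h3 (Nat.cast_nonneg (α := ℝ) L)
  simp only [hg] at *
  linarith


/-- The product of the four linear forms `ut ± vw`, `vt ± uw`. -/
def quarticForm (u v w t : ℤ) : ℤ := (u * t + v * w) * (u * t - v * w) * (v * t + u * w) * (v * t - u * w)

theorem card_roots_quarticForm (q : ℕ) (hq : q.Prime) (u v w : ℤ)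
    (hD : ¬ (q : ℤ) ∣ 2 * u * v * w * (u ^ 2 - v ^ 2) * (u ^ 2 + v ^ 2)) :
    ((Finset.range q).filter (fun t : ℕ => (q : ℤ) ∣ quarticForm u v w t)).card = 4 := by
  have : Fact q.Prime := ⟨hq⟩
  rw [← ZMod.intCast_zmod_eq_zero_iff_dvd] at hD
  push_cast at hD
  simp only [mul_eq_zero, not_or] at hD
  obtain ⟨⟨⟨⟨⟨h2, hu⟩, hv⟩, hw⟩, hm⟩, hp⟩ := hD
  set U : ZMod q := (u : ZMod q)
  set V : ZMod q := (v : ZMod q)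
  set W : ZMod q := (w : ZMod q)
  set a : ZMod q := V * W / U with ha
  set b : ZMod q := U * W / V with hb
  have haU : U * a = V * W := by rw [ha]; field_simp
  have hbV : V * b = U * W := by rw [hb]; field_simp
  have ha0 : a ≠ 0 := by rw [ha]; exact div_ne_zero (mul_ne_zero hv hw) hu
  have hb0 : b ≠ 0 := by rw [hb]; exact div_ne_zero (mul_ne_zero hu hw) hv
  have hneg : ∀ x : ZMod q, x ≠ 0 → x ≠ -x := by
    intro x hx h
    have : (2 : ZMod q) * x = 0 := by linear_combination h
    exact (mul_ne_zero h2 hx) this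
  have hab : a ≠ b := by
    intro h
    have : W * (U ^ 2 - V ^ 2) = 0 := by linear_combination V * haU - U * hbV - U * V * h
    exact mul_ne_zero hw hm this
  have hab' : a ≠ -b := by
    intro h
    have : W * (U ^ 2 + V ^ 2) = 0 := by linear_combination - V * haU - U * hbV + U * V * h
    exact mul_ne_zero hw hp this
  have hset : (Finset.range q).filter (fun t : ℕ => (q : ℤ) ∣ quarticForm u v w t) =
      ({a, -a, b, -b} : Finset (ZMod q)).image ZMod.val := by
    ext t
    simp only [Finset.mem_filter, Finset.mem_range, Finset.mem_image]
    have key : (q : ℤ) ∣ quarticForm u v w t ↔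
        (t : ZMod q) ∈ ({a, -a, b, -b} : Finset (ZMod q)) := by
      rw [← ZMod.intCast_zmod_eq_zero_iff_dvd, quarticForm]
      push_cast
      simp only [mul_eq_zero, Finset.mem_insert, Finset.mem_singleton]
      have e1 : U * t + V * W = U * (t - -a) := by linear_combination -haU
      have e2 : U * t - V * W = U * (t - a) := by linear_combination haU
      have e3 : V * t + U * W = V * (t - -b) := by linear_combination -hbV
      have e4 : V * t - U * W = V * (t - b) := by linear_combination hbV
      rw [e1, e2, e3, e4]
      simp only [mul_eq_zero, hu, hv, false_or, sub_eq_zero]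
      tauto
    rw [key]
    constructor
    · rintro ⟨h, h'⟩
      exact ⟨t, h', ZMod.val_cast_of_lt h⟩
    · rintro ⟨x, hx, rfl⟩
      exact ⟨ZMod.val_lt x, by rwa [ZMod.natCast_zmod_val]⟩
  rw [hset, Finset.card_image_of_injective _ (ZMod.val_injective q)]
  have hna : -a ≠ b := fun h => hab' (by rw [← h, neg_neg])
  have hnab : -a ≠ -b := fun h => hab (neg_injective h)
  rw [Finset.card_insert_of_notMem, Finset.card_insert_of_notMem, Finset.card_insert_of_notMem,
    Finset.card_singleton]
  · simpa using hneg b hb0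
  · simp only [Finset.mem_insert, Finset.mem_singleton, not_or]
    exact ⟨hna, hnab⟩
  · simp only [Finset.mem_insert, Finset.mem_singleton, not_or]
    exact ⟨hneg a ha0, hab, hab'⟩

theorem quarticForm_dvd_mod (q : ℕ) (u v w : ℤ) (t : ℕ) :
    (q : ℤ) ∣ quarticForm u v w (t % q : ℕ) ↔ (q : ℤ) ∣ quarticForm u v w t := by
  rw [← ZMod.intCast_zmod_eq_zero_iff_dvd, ← ZMod.intCast_zmod_eq_zero_iff_dvd, quarticForm,
    quarticForm]
  push_cast
  rfl

/-- The sieve bound with explicit parameters: the level is `2 ^ h` and the truncation is at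
`100 * J` prime factors. -/
theorem card_sifted_quarticForm_le_explicit (u v w : ℤ) (L h J m : ℕ) (hh : 1 ≤ h) (hhJ : h ≤ 2 ^ J)
    (hJ : 1 ≤ J)
    (hD0 : 2 * u * v * w * (u ^ 2 - v ^ 2) * (u ^ 2 + v ^ 2) ≠ 0)
    (hD : (2 * u * v * w * (u ^ 2 - v ^ 2) * (u ^ 2 + v ^ 2)).natAbs ≤ 2 ^ (2 ^ J))
    (hm : 2 ^ h ≤ m) :
    (((Finset.range L).filter (fun t : ℕ => ∀ q : ℕ, q.Prime → 2 < q → q ≤ m →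
      ¬ (q : ℤ) ∣ quarticForm u v w t)).card : ℝ) ≤
      L * (((h * Real.log 2)⁻¹) ^ 4 * (Real.exp 48 * (J : ℝ) ^ 32) +
        ((2 : ℝ) ^ (100 * J))⁻¹ * Real.exp (40 + 32 * J)) +
      (4 * 2 ^ h : ℝ) ^ (100 * J) * Real.exp 1 := by
  set D := 2 * u * v * w * (u ^ 2 - v ^ 2) * (u ^ 2 + v ^ 2) with hDdef
  set Q := Nat.primesBelow (2 ^ h) with hQ
  set P : Finset ℕ := Q.filter (fun q : ℕ => ¬ (q : ℤ) ∣ D) with hP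
  set R : ℕ → Finset ℕ := fun q => (Finset.range q).filter (fun t : ℕ => (q : ℤ) ∣ quarticForm u v w t)
  have hPp : ∀ q ∈ P, q.Prime := fun q hq => Nat.prime_of_mem_primesBelow (Finset.mem_filter.1 hq).1
  have hRc : ∀ q ∈ P, (R q).card = 4 := fun q hq =>
    card_roots_quarticForm q (hPp q hq) u v w (Finset.mem_filter.1 hq).2
  have hPcard : P.card ≤ 2 ^ h := by
    refine (Finset.card_filter_le _ _).trans ?_
    rw [hQ, Nat.primesBelow]
    exact (Finset.card_filter_le _ _).trans (by simp)
  have hlog2 : 0 < Real.log 2 := Real.log_pos (by norm_num)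
  have hJ' : (1 : ℝ) ≤ J := by exact_mod_cast hJ
  have hmain := brun_pure_sieve P hPp R 4 (by norm_num) (fun q _ => Finset.filter_subset _ _) hRc
    L (100 * J) (by exact Even.mul_right (by decide) _) (2 ^ h) Nat.one_le_two_pow hPcard
  have hsub : (Finset.range L).filter (fun t : ℕ => ∀ q : ℕ, q.Prime → 2 < q → q ≤ m →
      ¬ (q : ℤ) ∣ quarticForm u v w t) ⊆ (Finset.range L).filter (fun t => ∀ q ∈ P, t % q ∉ R q) := by
    intro t ht
    simp only [Finset.mem_filter] at ht ⊢
    refine ⟨ht.1, fun q hq hmem => ?_⟩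
    have hqp := hPp q hq
    have hq2 : 2 < q := by
      refine lt_of_le_of_ne hqp.two_le ?_
      rintro rfl
      refine (Finset.mem_filter.1 hq).2 ⟨u * v * w * (u ^ 2 - v ^ 2) * (u ^ 2 + v ^ 2), ?_⟩
      rw [hDdef]; push_cast; ring
    have hqm : q ≤ m := (Nat.lt_of_mem_primesBelow (Finset.mem_filter.1 hq).1).le.trans hm
    exact ht.2 q hqp hq2 hqm ((quarticForm_dvd_mod q u v w t).1 (Finset.mem_filter.1 hmem).2)
  have hle : (((Finset.range L).filter (fun t : ℕ => ∀ q : ℕ, q.Prime → 2 < q → q ≤ m →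
      ¬ (q : ℤ) ∣ quarticForm u v w t)).card : ℝ) ≤
      (((Finset.range L).filter (fun t => ∀ q ∈ P, t % q ∉ R q)).card : ℝ) := by
    exact_mod_cast Finset.card_le_card hsub
  have hsumP : ∑ q ∈ P, (q : ℝ)⁻¹ ≤ 5 + 4 * J := by
    have h1 : ∑ q ∈ P, (q : ℝ)⁻¹ ≤ ∑ q ∈ Nat.primesLE (2 ^ h), (q : ℝ)⁻¹ := by
      refine Finset.sum_le_sum_of_subset_of_nonneg ?_ fun _ _ _ => by positivity
      intro q hq
      exact Nat.mem_primesLE.2 ⟨(Nat.lt_of_mem_primesBelow (Finset.mem_filter.1 hq).1).le, hPp q hq⟩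
    have h2 := sum_inv_primesLE_two_pow_le h hh
    have h3 : Real.log h ≤ J := by
      have : Real.log h ≤ Real.log ((2 : ℝ) ^ J) :=
        Real.log_le_log (by exact_mod_cast hh) (by exact_mod_cast hhJ)
      rw [Real.log_pow] at this
      have h4 : Real.log 2 ≤ 1 := by linarith [Real.log_two_lt_d9]
      nlinarith
    linarith
  have hexp : Real.exp (2 * (4 : ℕ) * ∑ q ∈ P, (q : ℝ)⁻¹) ≤ Real.exp (40 + 32 * J) := by
    rw [Real.exp_le_exp]
    push_cast
    linarith
  have hq1 : ∀ q ∈ Q, (0 : ℝ) < 1 - (q : ℝ)⁻¹ := by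
    intro q hq
    have : (q : ℝ)⁻¹ < 1 := inv_lt_one_of_one_lt₀
      (by exact_mod_cast (Nat.prime_of_mem_primesBelow hq).one_lt)
    linarith
  have hq2 : ∀ q ∈ Q, (q : ℝ)⁻¹ ≤ 1 / 2 := by
    intro q hq
    rw [one_div]
    exact inv_anti₀ (by norm_num) (by exact_mod_cast (Nat.prime_of_mem_primesBelow hq).two_le)
  have hprod : ∏ q ∈ P, (1 - (q : ℝ)⁻¹) ≤ (h * Real.log 2)⁻¹ * (Real.exp 12 * (J : ℝ) ^ 8) := by
    have e1 := prod_one_sub_inv_primesBelow_le (2 ^ h)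
      (by calc 2 = 2 ^ 1 := rfl
            _ ≤ 2 ^ h := Nat.pow_le_pow_right (by norm_num) hh)
    push_cast at e1
    rw [Real.log_pow, ← hQ, ← Finset.prod_filter_mul_prod_filter_not Q (fun q : ℕ => ¬ (q : ℤ) ∣ D),
      ← hP] at e1
    set B := Q.filter (fun q : ℕ => ¬ ¬ (q : ℤ) ∣ D) with hB
    have e2 : Real.exp (-(2 * ∑ q ∈ B, (q : ℝ)⁻¹)) ≤ ∏ q ∈ B, (1 - (q : ℝ)⁻¹) := by
      rw [Finset.mul_sum, ← Finset.sum_neg_distrib, Real.exp_sum]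
      refine Finset.prod_le_prod (fun _ _ => (Real.exp_pos _).le) fun q hq => ?_
      have hx := hq2 q (Finset.mem_filter.1 hq).1
      set x := (q : ℝ)⁻¹
      have hx0 : 0 ≤ x := by positivity
      have h3 := Real.add_one_le_exp (2 * x)
      rw [Real.exp_neg]
      refine inv_le_of_inv_le₀ (by linarith) ?_
      refine le_trans ?_ h3
      rw [inv_le_iff_one_le_mul₀ (by linarith)]
      nlinarith
    have e3 : ∑ q ∈ B, (q : ℝ)⁻¹ ≤ 6 + 4 * Real.log J := by
      refine le_trans ?_ (sum_inv_primeFactors_le D.natAbs J (Int.natAbs_ne_zero.2 hD0) hJ hD)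
      refine Finset.sum_le_sum_of_subset_of_nonneg ?_ fun _ _ _ => by positivity
      intro q hq
      have := Finset.mem_filter.1 hq
      rw [Nat.mem_primeFactors]
      exact ⟨Nat.prime_of_mem_primesBelow this.1, Int.natCast_dvd.1 (not_not.1 this.2),
        Int.natAbs_ne_zero.2 hD0⟩
    have e4 : (Real.exp 12 * (J : ℝ) ^ 8)⁻¹ ≤ ∏ q ∈ B, (1 - (q : ℝ)⁻¹) := by
      refine le_trans ?_ e2
      have : Real.exp 12 * (J : ℝ) ^ 8 = Real.exp (12 + 8 * Real.log J) := by
        rw [Real.exp_add, show (8 : ℝ) * Real.log J = ((8 : ℕ) : ℝ) * Real.log J by norm_num,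
          Real.exp_nat_mul, Real.exp_log (by linarith)]
      rw [this, ← Real.exp_neg, Real.exp_le_exp]
      linarith
    have e5 : 0 ≤ ∏ q ∈ P, (1 - (q : ℝ)⁻¹) :=
      Finset.prod_nonneg fun q hq => (hq1 q (Finset.mem_filter.1 hq).1).le
    have e6 := (mul_le_mul_of_nonneg_left e4 e5).trans e1
    rwa [← div_eq_mul_inv, div_le_iff₀ (by positivity)] at e6
  have hprod4 : ∏ q ∈ P, (1 - (4 : ℕ) * (q : ℝ)⁻¹) ≤
      ((h * Real.log 2)⁻¹) ^ 4 * (Real.exp 48 * (J : ℝ) ^ 32) := by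
    have e1 : ∏ q ∈ P, (1 - (4 : ℕ) * (q : ℝ)⁻¹) ≤ (∏ q ∈ P, (1 - (q : ℝ)⁻¹)) ^ 4 := by
      rw [← Finset.prod_pow]
      refine Finset.prod_le_prod (fun q hq => ?_) fun q hq => ?_
      · have h4 : 4 ≤ q := by
          rw [← hRc q hq]
          exact (Finset.card_filter_le _ _).trans (by simp)
        have : (4 : ℝ) ≤ q := by exact_mod_cast h4
        push_cast
        rw [sub_nonneg, ← div_eq_mul_inv, div_le_one (by linarith)]
        exact this
      · have hx := hq2 q (Finset.mem_filter.1 hq).1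
        have := one_add_mul_le_pow (a := -(q : ℝ)⁻¹) (by linarith) 4
        push_cast at this ⊢
        rw [sub_eq_add_neg, sub_eq_add_neg]
        linarith
    have e5 : 0 ≤ ∏ q ∈ P, (1 - (q : ℝ)⁻¹) :=
      Finset.prod_nonneg fun q hq => (hq1 q (Finset.mem_filter.1 hq).1).le
    refine e1.trans ((pow_le_pow_left₀ e5 hprod 4).trans (le_of_eq ?_))
    rw [mul_pow, mul_pow, ← Real.exp_nat_mul, ← pow_mul]
    norm_num
  refine hle.trans (hmain.trans ?_)
  push_cast at hprod4 hexp ⊢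
  gcongr


theorem exists_pow_le_mul_pow (k : ℕ) {b : ℝ} (hb : 1 < b) :
    ∃ C > 0, ∀ n : ℕ, (n : ℝ) ^ k ≤ C * b ^ n := by
  obtain ⟨C, hC⟩ := (tendsto_pow_const_div_const_pow_of_one_lt k hb).bddAbove_range
  refine ⟨max C 1, by positivity, fun n => ?_⟩
  have h := hC ⟨n, rfl⟩
  have hbn : 0 < b ^ n := by positivity
  simp only at h
  rw [div_le_iff₀ hbn] at h
  exact h.trans (by gcongr; exact le_max_left _ _)

theorem natAbs_discriminant_le (N m u v w : ℕ) (hN : N < 2 ^ m) (hu : u ≤ 2 * N) (hv : v ≤ 2 * N)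
    (hw : w ≤ 2 * N) (hm : 1 ≤ m) :
    (2 * u * v * w * ((u : ℤ) ^ 2 - v ^ 2) * (u ^ 2 + v ^ 2)).natAbs ≤ 2 ^ (16 * m) := by
  zify
  have hB : ((2 * N : ℕ) : ℤ) ≤ 2 ^ (m + 1) := by
    have : 2 * N ≤ 2 ^ (m + 1) := by rw [pow_succ]; omega
    exact_mod_cast this
  have hu' : (u : ℤ) ≤ 2 ^ (m + 1) := le_trans (by exact_mod_cast hu) hB
  have hv' : (v : ℤ) ≤ 2 ^ (m + 1) := le_trans (by exact_mod_cast hv) hB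
  have hw' : (w : ℤ) ≤ 2 ^ (m + 1) := le_trans (by exact_mod_cast hw) hB
  set b : ℤ := 2 ^ (m + 1) with hb
  have hu2 : (u : ℤ) ^ 2 ≤ b ^ 2 := pow_le_pow_left₀ (by positivity) hu' 2
  have hv2 : (v : ℤ) ^ 2 ≤ b ^ 2 := pow_le_pow_left₀ (by positivity) hv' 2
  have h1 : |(u : ℤ) ^ 2 - v ^ 2| ≤ b ^ 2 := by
    rw [abs_le]
    constructor <;> nlinarith [sq_nonneg (u : ℤ), sq_nonneg (v : ℤ)]
  have h2 : |(u : ℤ) ^ 2 + v ^ 2| ≤ 2 * b ^ 2 := by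
    rw [abs_of_nonneg (by positivity)]
    linarith
  have h3 : |2 * (u : ℤ) * v * w| ≤ 2 * b * b * b := by
    rw [abs_of_nonneg (by positivity)]
    gcongr
  have hb0 : 0 ≤ b := by positivity
  rw [abs_mul, abs_mul]
  calc |2 * (u : ℤ) * v * w| * |(u : ℤ) ^ 2 - v ^ 2| * |(u : ℤ) ^ 2 + v ^ 2|
      ≤ (2 * b * b * b) * b ^ 2 * (2 * b ^ 2) := by gcongr
    _ = 2 ^ (7 * (m + 1) + 2) := by rw [hb]; ring
    _ ≤ 2 ^ (16 * m) := pow_le_pow_right₀ (by norm_num) (by omega)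

theorem exists_sieve_main_le : ∃ K > 0, ∀ h J m : ℕ, 1 ≤ h → 1 ≤ m → m ≤ 3200 * J * h →
    2 ^ J ≤ 32 * m →
    ((h * Real.log 2)⁻¹) ^ 4 * (Real.exp 48 * (J : ℝ) ^ 32) ≤ K / (m : ℝ) ^ 3 := by
  obtain ⟨C₁, hC₁, h1⟩ := exists_pow_le_mul_pow 36 (b := 2) (by norm_num)
  have hlog2 : 0 < Real.log 2 := Real.log_pos (by norm_num)
  refine ⟨(3200 / Real.log 2) ^ 4 * Real.exp 48 * (32 * C₁), by positivity, ?_⟩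
  intro h J m hh hm e1 hJ
  have hm0 : (0 : ℝ) < m := by exact_mod_cast hm
  have hh0 : (0 : ℝ) < h := by exact_mod_cast hh
  have hJ' : (2 : ℝ) ^ J ≤ 32 * m := by exact_mod_cast hJ
  have hJ36 : (J : ℝ) ^ 36 ≤ 32 * C₁ * m := by
    calc (J : ℝ) ^ 36 ≤ C₁ * 2 ^ J := h1 J
      _ ≤ C₁ * (32 * m) := by gcongr
      _ = _ := by ring
  have e2 : (h * Real.log 2)⁻¹ ≤ 3200 / Real.log 2 * J / m := by
    rw [inv_le_iff_one_le_mul₀ (by positivity)]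
    have : 3200 / Real.log 2 * J / m * (h * Real.log 2) = 3200 * J * h / m := by
      field_simp
    rw [this, one_le_div hm0]
    exact_mod_cast e1
  calc ((h * Real.log 2)⁻¹) ^ 4 * (Real.exp 48 * (J : ℝ) ^ 32)
      ≤ (3200 / Real.log 2 * J / m) ^ 4 * (Real.exp 48 * (J : ℝ) ^ 32) := by gcongr
    _ = (3200 / Real.log 2) ^ 4 * Real.exp 48 * (J : ℝ) ^ 36 / m ^ 4 := by ring
    _ ≤ (3200 / Real.log 2) ^ 4 * Real.exp 48 * (32 * C₁ * m) / m ^ 4 := by gcongr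
    _ = _ := by field_simp

theorem sieve_tail_le (J m : ℕ) (hm : 1 ≤ m) (hJ : m ≤ 2 ^ J) :
    ((2 : ℝ) ^ (100 * J))⁻¹ * Real.exp (40 + 32 * J) ≤ Real.exp 40 / (m : ℝ) ^ 3 := by
  have hm0 : (0 : ℝ) < m := by exact_mod_cast hm
  have hJ' : (m : ℝ) ≤ 2 ^ J := by exact_mod_cast hJ
  have e1 : Real.exp 2 ≤ 8 := by
    have := Real.exp_one_lt_d9
    have h3 : Real.exp 2 = Real.exp 1 ^ 2 := by rw [← Real.exp_nat_mul]; norm_num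
    rw [h3]
    nlinarith [Real.exp_pos 1]
  have e2 : Real.exp (32 * J) ≤ 2 ^ (48 * J) := by
    have h3 : Real.exp (32 * J) = Real.exp 2 ^ (16 * J) := by
      rw [← Real.exp_nat_mul]; push_cast; ring_nf
    rw [h3]
    calc Real.exp 2 ^ (16 * J) ≤ 8 ^ (16 * J) := by gcongr
      _ = 2 ^ (48 * J) := by
        rw [show (8 : ℝ) = 2 ^ 3 by norm_num, ← pow_mul]; congr 1; ring
  have e3 : (m : ℝ) ^ 3 ≤ 2 ^ (52 * J) := by
    calc (m : ℝ) ^ 3 ≤ (2 ^ J) ^ 3 := by gcongr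
      _ = 2 ^ (3 * J) := by rw [← pow_mul]; congr 1; ring
      _ ≤ 2 ^ (52 * J) := pow_le_pow_right₀ (by norm_num) (by omega)
  rw [Real.exp_add, le_div_iff₀ (by positivity), inv_mul_eq_div, div_mul_eq_mul_div,
    div_le_iff₀ (by positivity)]
  calc Real.exp 40 * Real.exp (32 * J) * (m : ℝ) ^ 3
      ≤ Real.exp 40 * 2 ^ (48 * J) * 2 ^ (52 * J) := by gcongr
    _ = Real.exp 40 * 2 ^ (100 * J) := by rw [mul_assoc, ← pow_add]; congr 2; ring

theorem exists_sieve_error_le : ∃ K > 0, ∀ n h J L : ℕ, h * (800 * J) ≤ n →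
    2 ^ J ≤ 32 * (n + 1) → 2 ^ n ≤ L ^ 2 →
    (4 * 2 ^ h : ℝ) ^ (100 * J) * Real.exp 1 ≤ K * L / ((n + 1 : ℕ) : ℝ) ^ 3 := by
  obtain ⟨c, hc1, hc8⟩ : ∃ c : ℝ, 1 < c ∧ c ^ 8 = 2 := by
    refine ⟨(2 : ℝ) ^ (1 / 8 : ℝ), Real.one_lt_rpow (by norm_num) (by norm_num), ?_⟩
    rw [← Real.rpow_natCast, ← Real.rpow_mul (by norm_num)]; norm_num
  obtain ⟨C₂, hC₂, h2⟩ := exists_pow_le_mul_pow 203 hc1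
  obtain ⟨A, hA, hA'⟩ : ∃ A : ℝ, 0 < A ∧ ∀ x : ℝ, (32 * x) ^ 200 = A * x ^ 200 :=
    ⟨32 ^ 200, by positivity, fun x => mul_pow _ _ _⟩
  refine ⟨A * C₂ * c * Real.exp 1, by positivity, ?_⟩
  intro n h J L hhn hJ hL
  obtain ⟨m, hm⟩ : ∃ m, m = n + 1 := ⟨_, rfl⟩
  rw [← hm] at hJ ⊢
  have hm0 : (0 : ℝ) < m := by exact_mod_cast (show 0 < m by omega)
  have hJ' : (2 : ℝ) ^ J ≤ 32 * m := by exact_mod_cast hJ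
  have hc0 : 0 < c := by linarith
  have e1 : c ^ (4 * n) ≤ L := by
    refine le_of_sq_le_sq ?_ (by positivity)
    have : (c ^ (4 * n)) ^ 2 = 2 ^ n := by
      rw [← hc8, ← pow_mul, ← pow_mul]; congr 1; ring
    rw [this]
    exact_mod_cast hL
  have e2 : (4 * 2 ^ h : ℝ) ^ (100 * J) = c ^ (h * (800 * J)) * (2 ^ J) ^ 200 := by
    rw [mul_pow, ← hc8, show (4 : ℝ) = c ^ 16 by rw [show 16 = 8 * 2 from rfl, pow_mul, hc8]; norm_num]
    simp only [← pow_mul, ← pow_add]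
    congr 1
    ring
  rw [e2, le_div_iff₀ (by positivity)]
  calc c ^ (h * (800 * J)) * (2 ^ J) ^ 200 * Real.exp 1 * (m : ℝ) ^ 3
      ≤ c ^ n * (32 * m) ^ 200 * Real.exp 1 * (m : ℝ) ^ 3 := by
        have := pow_le_pow_right₀ hc1.le hhn
        gcongr
    _ = c ^ n * A * Real.exp 1 * (m : ℝ) ^ 203 := by rw [hA']; ring
    _ ≤ c ^ n * A * Real.exp 1 * (C₂ * c ^ m) := by gcongr; exact h2 m
    _ = A * C₂ * c * Real.exp 1 * c ^ (2 * n) := by rw [hm]; ring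
    _ ≤ A * C₂ * c * Real.exp 1 * c ^ (4 * n) := by
        have := pow_le_pow_right₀ hc1.le (show 2 * n ≤ 4 * n by omega)
        gcongr
    _ ≤ A * C₂ * c * Real.exp 1 * L := by gcongr

theorem exists_pow_three_le : ∃ K > 0, ∀ J m : ℕ, m ≤ 801 * J → 2 ^ J ≤ 32 * m →
    (m : ℝ) ^ 3 ≤ K := by
  obtain ⟨C₁, hC₁, h1⟩ := exists_pow_le_mul_pow 2 (b := 2) (by norm_num)
  refine ⟨(801 * (32 * 801 * C₁ + 1)) ^ 3, by positivity, ?_⟩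
  intro J m hmJ hJ
  have hm : (m : ℝ) ≤ 801 * J := by exact_mod_cast hmJ
  have hJ' : (2 : ℝ) ^ J ≤ 32 * m := by exact_mod_cast hJ
  have hJb : (J : ℝ) ≤ 32 * 801 * C₁ + 1 := by
    rcases Nat.eq_zero_or_pos J with rfl | hpos
    · push_cast; positivity
    have hJ0 : (0 : ℝ) < J := by exact_mod_cast hpos
    have h3 : (J : ℝ) * J ≤ J * (32 * 801 * C₁) := by
      calc (J : ℝ) * J = J ^ 2 := by ring
        _ ≤ C₁ * 2 ^ J := h1 J
        _ ≤ C₁ * (32 * (801 * J)) := by gcongr; exact hJ'.trans (by linarith)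
        _ = _ := by ring
    have h4 := le_of_mul_le_mul_left h3 hJ0
    linarith
  gcongr
  linarith

/-- The sieve bound for the values of `t` at which four linear forms are all almost prime. -/
theorem exists_card_sifted_quarticForm_le : ∃ C > 0, ∀ N u v w L : ℕ, 1 ≤ N → 1 ≤ v → v < u →
    1 ≤ w → u ≤ 2 * N → w ≤ 2 * N → N ≤ L ^ 2 →
    (((Finset.range L).filter (fun t : ℕ => ∀ q : ℕ, q.Prime → 2 < q → q ≤ Nat.sqrt N →
      ¬ (q : ℤ) ∣ quarticForm u v w t)).card : ℝ) ≤ C * L / ((Nat.log 2 N + 1 : ℕ) : ℝ) ^ 3 := by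
  obtain ⟨K₁, p1, hb1⟩ := exists_sieve_main_le
  obtain ⟨K₂, hK₂⟩ : ∃ K, K = Real.exp 40 := ⟨_, rfl⟩
  have p2 : 0 < K₂ := by rw [hK₂]; positivity
  obtain ⟨K₃, p3, hb3⟩ := exists_sieve_error_le
  obtain ⟨K₄, p4, hb4⟩ := exists_pow_three_le
  refine ⟨K₁ + K₂ + K₃ + K₄, by positivity, ?_⟩
  intro N u v w L hN hv hvu hw hu hwN hL
  have hNlow : 2 ^ (Nat.log 2 N) ≤ N := Nat.pow_log_le_self 2 (by omega)
  have hNup : N < 2 ^ (Nat.log 2 N + 1) := Nat.lt_pow_succ_log_self (by norm_num) N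
  generalize Nat.log 2 N = n at hNlow hNup ⊢
  obtain ⟨J, hJ1, hJlow, hJup⟩ : ∃ J, 1 ≤ J ∧ 16 * (n + 1) ≤ 2 ^ J ∧ 2 ^ J ≤ 32 * (n + 1) := by
    refine ⟨Nat.log 2 (16 * (n + 1)) + 1, by omega, (Nat.lt_pow_succ_log_self (by norm_num) _).le, ?_⟩
    have := Nat.pow_log_le_self 2 (x := 16 * (n + 1)) (by omega)
    rw [pow_succ]
    omega
  by_cases hsmall : n < 800 * J
  · have hm3 := hb4 J (n + 1) (by omega) hJup
    have hcard : (((Finset.range L).filter (fun t : ℕ => ∀ q : ℕ, q.Prime → 2 < q → q ≤ Nat.sqrt N →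
      ¬ (q : ℤ) ∣ quarticForm u v w t)).card : ℝ) ≤ L := by
      exact_mod_cast (Finset.card_filter_le _ _).trans (by simp)
    refine hcard.trans ?_
    rw [le_div_iff₀ (by positivity), mul_comm]
    gcongr
    linarith
  · push Not at hsmall
    obtain ⟨h, hhn, hhn', hh1⟩ : ∃ h, h * (800 * J) ≤ n ∧ n < (h + 1) * (800 * J) ∧ 1 ≤ h :=
      ⟨n / (800 * J), Nat.div_mul_le_self _ _, (Nat.div_lt_iff_lt_mul (by positivity)).1 (Nat.lt_succ_self _),
        (Nat.one_le_div_iff (by positivity)).2 hsmall⟩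
    have hh2 : 2 * h ≤ n := by nlinarith
    have hsqrt : 2 ^ h ≤ Nat.sqrt N := by
      rw [Nat.le_sqrt, ← pow_add]
      exact (Nat.pow_le_pow_right (by norm_num) (by omega)).trans hNlow
    have hD0 : 2 * (u : ℤ) * v * w * ((u : ℤ) ^ 2 - v ^ 2) * (u ^ 2 + v ^ 2) ≠ 0 := by
      have : (v : ℤ) ^ 2 < (u : ℤ) ^ 2 := by
        exact_mod_cast Nat.pow_lt_pow_left hvu (by norm_num)
      have hu0 : (0 : ℤ) < u := by exact_mod_cast (by omega : 0 < u)
      have hv0 : (0 : ℤ) < v := by exact_mod_cast (by omega : 0 < v)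
      have hw0 : (0 : ℤ) < w := by exact_mod_cast (by omega : 0 < w)
      have h5 : (0 : ℤ) < (u : ℤ) ^ 2 - v ^ 2 := by linarith
      positivity
    have hD := (natAbs_discriminant_le N (n + 1) u v w hNup hu (by omega) hwN (by omega)).trans
      (Nat.pow_le_pow_right (by norm_num) hJlow)
    refine (card_sifted_quarticForm_le_explicit u v w L h J (Nat.sqrt N) hh1 (by omega) hJ1
      hD0 hD hsqrt).trans ?_
    have b1 := hb1 h J (n + 1) hh1 (by omega) (by nlinarith) hJup
    have b2 := sieve_tail_le J (n + 1) (by omega) (by omega)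
    rw [← hK₂] at b2
    have b3 := hb3 n h J L hhn hJup (hNlow.trans hL)
    have hm0 : (0 : ℝ) < ((n + 1 : ℕ) : ℝ) := by positivity
    generalize ((n + 1 : ℕ) : ℝ) = m at b1 b2 b3 hm0 ⊢
    have e1 : (K₁ + K₂ + K₃ + K₄) * L / m ^ 3 =
        L * (K₁ / m ^ 3 + K₂ / m ^ 3) + K₃ * L / m ^ 3 + K₄ * L / m ^ 3 := by ring
    have e2 : 0 ≤ K₄ * L / m ^ 3 := by positivity
    have e3 := mul_le_mul_of_nonneg_left (add_le_add b1 b2) (Nat.cast_nonneg (α := ℝ) L)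
    linarith


/-- The quadruples `(u, v, w, t)` in a hyperbolic region at which the value of the quartic form
has no small odd prime factor. -/
def siftedQuadruples (N : ℕ) : Finset (ℕ × ℕ × ℕ × ℕ) :=
  (Finset.Icc 1 (Nat.sqrt (4 * N))).biUnion fun u => (Finset.Ico 1 u).biUnion fun v =>
    (Finset.Icc 1 (2 * N / u)).biUnion fun w =>
      ((Finset.range (2 * N / u + 1)).filter (fun t : ℕ => ∀ q : ℕ, q.Prime → 2 < q →
        q ≤ Nat.sqrt N → ¬ (q : ℤ) ∣ quarticForm u v w t)).image fun t => (u, v, w, t)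

theorem mem_siftedQuadruples {N u v w t : ℕ} (hv : 1 ≤ v) (hvu : v < u) (hw : 1 ≤ w)
    (hu : u * u ≤ 4 * N) (huw : u * w ≤ 2 * N) (hut : u * t ≤ 2 * N)
    (h : ∀ q : ℕ, q.Prime → 2 < q → q ≤ Nat.sqrt N → ¬ (q : ℤ) ∣ quarticForm u v w t) :
    (u, v, w, t) ∈ siftedQuadruples N := by
  have hu0 : 0 < u := by omega
  simp only [siftedQuadruples, Finset.mem_biUnion, Finset.mem_image, Finset.mem_filter,
    Finset.mem_Icc, Finset.mem_Ico, Finset.mem_range]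
  refine ⟨u, ⟨by omega, Nat.le_sqrt.2 hu⟩, v, ⟨hv, hvu⟩, w, ⟨hw, ?_⟩, t, ⟨?_, h⟩, rfl⟩
  · rw [Nat.le_div_iff_mul_le hu0, mul_comm]; exact huw
  · rw [Nat.lt_succ_iff, Nat.le_div_iff_mul_le hu0, mul_comm]; exact hut

theorem exists_card_siftedQuadruples_le : ∃ C > 0, ∀ N : ℕ, 1 ≤ N →
    ((siftedQuadruples N).card : ℝ) ≤ C * N ^ 2 / ((Nat.log 2 N + 1 : ℕ) : ℝ) ^ 2 := by
  obtain ⟨C, hC, hsieve⟩ := exists_card_sifted_quarticForm_le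
  refine ⟨32 * C, by positivity, fun N hN => ?_⟩
  have hN0 : (0 : ℝ) < N := by exact_mod_cast hN
  have hNup : N < 2 ^ (Nat.log 2 N + 1) := Nat.lt_pow_succ_log_self (by norm_num) N
  obtain ⟨m, hm⟩ : ∃ m, m = Nat.log 2 N + 1 := ⟨_, rfl⟩
  rw [← hm] at hNup ⊢
  have hm1 : (1 : ℝ) ≤ m := by exact_mod_cast (show 1 ≤ m by omega)
  have hinner : ∀ u ∈ Finset.Icc 1 (Nat.sqrt (4 * N)), ∀ v ∈ Finset.Ico 1 u,
      ∀ w ∈ Finset.Icc 1 (2 * N / u), ((((Finset.range (2 * N / u + 1)).filter (fun t : ℕ =>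
        ∀ q : ℕ, q.Prime → 2 < q → q ≤ Nat.sqrt N →
          ¬ (q : ℤ) ∣ quarticForm u v w t)).image fun t => (u, v, w, t)).card : ℝ) ≤
        C * (4 * N / u) / m ^ 3 := by
    intro u hu v hv w hw
    rw [Finset.mem_Icc, Nat.le_sqrt] at hu
    rw [Finset.mem_Ico] at hv
    rw [Finset.mem_Icc] at hw
    have hu0 : (0 : ℝ) < u := by exact_mod_cast hu.1
    have huN : u ≤ 2 * N := by nlinarith
    have hwN : w ≤ 2 * N := hw.2.trans (Nat.div_le_self _ _)
    have hL : N ≤ (2 * N / u + 1) ^ 2 := by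
      have h1 : 2 * N < u * (2 * N / u + 1) := Nat.lt_mul_div_succ _ hu.1
      by_contra! hcon
      have h2 : (2 * N) ^ 2 < u ^ 2 * (2 * N / u + 1) ^ 2 := by
        rw [← mul_pow]; exact Nat.pow_lt_pow_left h1 (by norm_num)
      have h3 : u ^ 2 * (2 * N / u + 1) ^ 2 ≤ (4 * N) * N := by
        apply Nat.mul_le_mul
        · rw [sq]; exact hu.2
        · exact hcon.le
      nlinarith
    have h1 := hsieve N u v w (2 * N / u + 1) hN hv.1 hv.2 hw.1 huN hwN hL
    rw [← hm] at h1
    have h2 : ((2 * N / u + 1 : ℕ) : ℝ) ≤ 4 * N / u := by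
      have h3 : ((2 * N / u : ℕ) : ℝ) ≤ ((2 * N : ℕ) : ℝ) / u := Nat.cast_div_le
      have h4 : (1 : ℝ) ≤ ((2 * N : ℕ) : ℝ) / u := by
        rw [one_le_div hu0]; exact_mod_cast huN
      push_cast at h3 h4 ⊢
      have : (4 : ℝ) * N / u = 2 * N / u + 2 * N / u := by ring
      linarith
    refine (Nat.cast_le.2 Finset.card_image_le).trans (h1.trans ?_)
    gcongr
  have hsum : ((siftedQuadruples N).card : ℝ) ≤
      ∑ u ∈ Finset.Icc 1 (Nat.sqrt (4 * N)), 8 * C * N ^ 2 / m ^ 3 * (u : ℝ)⁻¹ := by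
    refine (Nat.cast_le.2 Finset.card_biUnion_le).trans ?_
    rw [Nat.cast_sum]
    refine Finset.sum_le_sum fun u hu => ?_
    have hu0 : (0 : ℝ) < u := by exact_mod_cast (Finset.mem_Icc.1 hu).1
    have h1 : ∀ v ∈ Finset.Ico 1 u, (((Finset.Icc 1 (2 * N / u)).biUnion fun w =>
        ((Finset.range (2 * N / u + 1)).filter (fun t : ℕ => ∀ q : ℕ, q.Prime → 2 < q →
        q ≤ Nat.sqrt N → ¬ (q : ℤ) ∣ quarticForm u v w t)).image fun t => (u, v, w, t)).card : ℝ)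
        ≤ (2 * N / u) * (C * (4 * N / u) / m ^ 3) := by
      intro v hv
      refine (Nat.cast_le.2 Finset.card_biUnion_le).trans ?_
      rw [Nat.cast_sum]
      refine (Finset.sum_le_card_nsmul _ _ _ (hinner u hu v hv)).trans ?_
      rw [nsmul_eq_mul, Nat.card_Icc, Nat.add_sub_cancel]
      have h3 : ((2 * N / u : ℕ) : ℝ) ≤ ((2 * N : ℕ) : ℝ) / u := Nat.cast_div_le
      push_cast at h3
      gcongr
    refine (Nat.cast_le.2 Finset.card_biUnion_le).trans ?_
    rw [Nat.cast_sum]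
    refine (Finset.sum_le_card_nsmul _ _ _ h1).trans ?_
    rw [nsmul_eq_mul, Nat.card_Ico]
    have h3 : ((u - 1 : ℕ) : ℝ) ≤ u := by exact_mod_cast Nat.sub_le _ _
    calc ((u - 1 : ℕ) : ℝ) * ((2 * N / u) * (C * (4 * N / u) / m ^ 3))
        ≤ u * ((2 * N / u) * (C * (4 * N / u) / m ^ 3)) := by gcongr
      _ = _ := by field_simp; ring
  have hharm : ∑ u ∈ Finset.Icc 1 (Nat.sqrt (4 * N)), (u : ℝ)⁻¹ ≤ 4 * m := by
    have h1 := harmonic_le_one_add_log (Nat.sqrt (4 * N))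
    rw [harmonic_eq_sum_Icc] at h1
    push_cast at h1
    have h2 : Real.log (Nat.sqrt (4 * N)) ≤ m + 2 := by
      have h3 : ((Nat.sqrt (4 * N) : ℕ) : ℝ) ≤ 2 ^ (m + 2) := by
        have : Nat.sqrt (4 * N) ≤ 2 ^ (m + 2) := by
          refine (Nat.sqrt_le_self _).trans ?_
          rw [pow_add]; omega
        exact_mod_cast this
      have h4 : (0 : ℝ) < (Nat.sqrt (4 * N) : ℕ) := by
        have : 0 < Nat.sqrt (4 * N) := Nat.sqrt_pos.2 (by omega)
        exact_mod_cast this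
      have h5 := Real.log_le_log h4 h3
      rw [Real.log_pow] at h5
      push_cast at h5
      have := Real.log_two_lt_d9
      nlinarith
    linarith
  refine hsum.trans ?_
  rw [← Finset.mul_sum]
  calc 8 * C * N ^ 2 / (m : ℝ) ^ 3 * ∑ u ∈ Finset.Icc 1 (Nat.sqrt (4 * N)), (u : ℝ)⁻¹
      ≤ 8 * C * N ^ 2 / (m : ℝ) ^ 3 * (4 * m) := by gcongr
    _ = _ := by field_simp; ring

/-- Solutions of `xy = zw` factor through a common matrix of divisors. -/
theorem exists_factors_of_mul_eq_mul {x y z w : ℕ} (hx : 0 < x) (hz : 0 < z)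
    (h : x * y = z * w) :
    ∃ a b c d : ℕ, x = a * b ∧ z = a * c ∧ y = c * d ∧ w = b * d := by
  obtain ⟨b, c, hbc, hb, hc⟩ := Nat.exists_coprime x z
  have hg : 0 < Nat.gcd x z := Nat.gcd_pos_of_pos_left _ hx
  generalize Nat.gcd x z = a at hb hc hg
  subst hb hc
  have hb0 : 0 < b := Nat.pos_of_mul_pos_right hx
  have h1 : b * y = c * w := by
    refine Nat.eq_of_mul_eq_mul_left hg ?_
    linarith
  obtain ⟨d, rfl⟩ : c ∣ y := hbc.symm.dvd_of_dvd_mul_left (Dvd.intro _ h1.symm)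
  refine ⟨a, b, c, d, by ring, by ring, rfl, ?_⟩
  have hc0 : 0 < c := Nat.pos_of_mul_pos_right hz
  refine Nat.eq_of_mul_eq_mul_left hc0 ?_
  linarith

/-- Quadruples of primes in `(√N, N]` with `p₁² + p₂² = p₃² + p₄²` whose largest entry is `p₁`. -/
def primeQuadruples (N : ℕ) : Finset (ℕ × ℕ × ℕ × ℕ) :=
  (Finset.range (N + 1) ×ˢ Finset.range (N + 1) ×ˢ Finset.range (N + 1) ×ˢ
    Finset.range (N + 1)).filter fun p => (p.1.Prime ∧ p.2.1.Prime ∧ p.2.2.1.Prime ∧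
      p.2.2.2.Prime) ∧ (Nat.sqrt N < p.1 ∧ Nat.sqrt N < p.2.1 ∧ Nat.sqrt N < p.2.2.1 ∧
      Nat.sqrt N < p.2.2.2) ∧ p.1 ^ 2 + p.2.1 ^ 2 = p.2.2.1 ^ 2 + p.2.2.2 ^ 2 ∧
      p.2.2.1 < p.1 ∧ p.2.2.2 < p.1

theorem not_dvd_sixteen_mul_primes {q p₁ p₂ p₃ p₄ M : ℕ} (hq : q.Prime) (hq2 : 2 < q) (hqM : q ≤ M)
    (hp : p₁.Prime ∧ p₂.Prime ∧ p₃.Prime ∧ p₄.Prime) (h : M < p₁ ∧ M < p₂ ∧ M < p₃ ∧ M < p₄) :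
    ¬ q ∣ 16 * (p₁ * p₂ * p₃ * p₄) := by
  intro hd
  have key : ∀ p : ℕ, p.Prime → M < p → ¬ q ∣ p := by
    intro p hp hM hqp
    have := (Nat.prime_dvd_prime_iff_eq hq hp).1 hqp
    omega
  rcases hq.dvd_mul.1 hd with h1 | h1
  · have h2 : q ∣ 2 ^ 4 := h1
    have := (Nat.prime_dvd_prime_iff_eq hq Nat.prime_two).1 (hq.dvd_of_dvd_pow h2)
    omega
  · rw [hq.dvd_mul, hq.dvd_mul, hq.dvd_mul] at h1
    rcases h1 with ((h1 | h1) | h1) | h1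
    · exact key _ hp.1 h.1 h1
    · exact key _ hp.2.1 h.2.1 h1
    · exact key _ hp.2.2.1 h.2.2.1 h1
    · exact key _ hp.2.2.2 h.2.2.2 h1

theorem primeQuadruples_subset (N : ℕ) : primeQuadruples N ⊆
    (siftedQuadruples N).image (fun x => ((x.1 * x.2.2.2 + x.2.1 * x.2.2.1) / 2,
      (x.2.1 * x.2.2.2 - x.1 * x.2.2.1) / 2, (x.1 * x.2.2.2 - x.2.1 * x.2.2.1) / 2,
      (x.2.1 * x.2.2.2 + x.1 * x.2.2.1) / 2)) ∪
    (siftedQuadruples N).image (fun x => ((x.2.1 * x.2.2.2 + x.1 * x.2.2.1) / 2,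
      (x.1 * x.2.2.2 - x.2.1 * x.2.2.1) / 2, (x.1 * x.2.2.1 - x.2.1 * x.2.2.2) / 2,
      (x.1 * x.2.2.2 + x.2.1 * x.2.2.1) / 2)) := by
  rintro ⟨p₁, p₂, p₃, p₄⟩ hp
  simp only [primeQuadruples, Finset.mem_filter, Finset.mem_product, Finset.mem_range,
    Nat.lt_succ_iff] at hp
  obtain ⟨⟨h1N, h2N, h3N, h4N⟩, hprime, hM, heq, h31, h41⟩ := hp
  have h24 : p₂ < p₄ := by nlinarith
  obtain ⟨x, rfl⟩ := Nat.exists_eq_add_of_lt h31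
  obtain ⟨z, rfl⟩ := Nat.exists_eq_add_of_lt h24
  obtain ⟨a, b, c, d, hx, hz, hy, hw⟩ := exists_factors_of_mul_eq_mul (x := x + 1) (y := 2 * p₃ + x + 1)
    (z := z + 1) (w := 2 * p₂ + z + 1) (by omega) (by omega) (by nlinarith)
  have hp2 : 0 < p₂ := hprime.2.1.pos
  have hp3 : 0 < p₃ := hprime.2.2.1.pos
  have ha : 0 < a := Nat.pos_of_mul_pos_right (by omega : 0 < a * b)
  have hb : 0 < b := Nat.pos_of_mul_pos_left (by omega : 0 < a * b)
  have hc : 0 < c := Nat.pos_of_mul_pos_left (by omega : 0 < a * c)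
  have hd : 0 < d := Nat.pos_of_mul_pos_left (by omega : 0 < b * d)
  have hbc : b < c := by
    by_contra! hcb
    have had : a < d := by
      by_contra! hda
      have := Nat.mul_le_mul hcb hda
      have := mul_comm a b
      omega
    nlinarith
  have had : a < d := by
    by_contra! hda
    nlinarith
  have hprod : (c * d + b * a : ℤ) * (c * d - b * a) * (b * d + c * a) * (b * d - c * a) =
      ((16 * ((p₃ + x + 1) * p₂ * p₃ * (p₂ + z + 1)) : ℕ) : ℤ) := by
    have ex : (b * a : ℤ) = x + 1 := by rw [mul_comm]; exact_mod_cast hx.symm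
    have ez : (c * a : ℤ) = z + 1 := by rw [mul_comm]; exact_mod_cast hz.symm
    have ey : (c * d : ℤ) = 2 * p₃ + x + 1 := by exact_mod_cast hy.symm
    have ew : (b * d : ℤ) = 2 * p₂ + z + 1 := by exact_mod_cast hw.symm
    rw [ex, ez, ey, ew]
    push_cast
    ring
  have hN1 : 1 ≤ N := by omega
  rw [Finset.mem_union, Finset.mem_image, Finset.mem_image]
  have hcd : c * d ≤ 2 * N := by omega
  have hbd : b * d ≤ 2 * N := by omega
  have hca : c * a ≤ 2 * N := by rw [mul_comm]; omega
  by_cases hdN : N < d * d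
  · left
    refine ⟨(c, b, a, d), mem_siftedQuadruples hb hbc ha ?_ hca hcd ?_, ?_⟩
    · by_contra! hcon
      have : (2 * N) * (2 * N) < (c * d) * (c * d) := by nlinarith
      have := Nat.mul_le_mul hcd hcd
      omega
    · intro q hq hq2 hqM hdvd
      rw [quarticForm, hprod, Int.natCast_dvd_natCast] at hdvd
      exact not_dvd_sixteen_mul_primes hq hq2 hqM hprime hM hdvd
    · simp only [Prod.mk.injEq]
      have := mul_comm a b
      have := mul_comm a c
      refine ⟨?_, ?_, ?_, ?_⟩ <;> omega
  · right
    push Not at hdN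
    refine ⟨(d, a, c, b), mem_siftedQuadruples ha had hc (by omega) ?_ ?_ ?_, ?_⟩
    · rw [mul_comm]; exact hcd
    · rw [mul_comm]; exact hbd
    · intro q hq hq2 hqM hdvd
      have e1 : quarticForm d a c b =
          -((c * d + b * a : ℤ) * (c * d - b * a) * (b * d + c * a) * (b * d - c * a)) := by
        rw [quarticForm]; ring
      rw [e1, dvd_neg, hprod, Int.natCast_dvd_natCast] at hdvd
      exact not_dvd_sixteen_mul_primes hq hq2 hqM hprime hM hdvd
    · simp only [Prod.mk.injEq]
      have := mul_comm d b
      have := mul_comm d c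
      refine ⟨?_, ?_, ?_, ?_⟩ <;> omega

theorem exists_card_primeQuadruples_le : ∃ C > 0, ∀ N : ℕ, 1 ≤ N →
    ((primeQuadruples N).card : ℝ) ≤ C * N ^ 2 / ((Nat.log 2 N + 1 : ℕ) : ℝ) ^ 2 := by
  obtain ⟨C, hC, h⟩ := exists_card_siftedQuadruples_le
  refine ⟨2 * C, by positivity, fun N hN => ?_⟩
  have h1 : (primeQuadruples N).card ≤ 2 * (siftedQuadruples N).card := by
    refine (Finset.card_le_card (primeQuadruples_subset N)).trans ((Finset.card_union_le _ _).trans ?_)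
    rw [two_mul]
    exact add_le_add Finset.card_image_le Finset.card_image_le
  calc ((primeQuadruples N).card : ℝ) ≤ 2 * (siftedQuadruples N).card := by exact_mod_cast h1
    _ ≤ 2 * (C * N ^ 2 / ((Nat.log 2 N + 1 : ℕ) : ℝ) ^ 2) := by gcongr; exact h N hN
    _ = _ := by ring

/-- The log-weighted number of solutions of `p₁² + p₂² = p₃² + p₄²` in `P`. -/
def logEnergy (P : Finset ℕ) : ℝ :=
  ∑ x ∈ P ×ˢ P, ∑ y ∈ P ×ˢ P, if x.1 ^ 2 + x.2 ^ 2 = y.1 ^ 2 + y.2 ^ 2 then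
    (Real.log x.1 * Real.log x.2) * (Real.log y.1 * Real.log y.2) else 0

theorem sum_ite_mem_le_card {α β : Type*} [DecidableEq β] (s : Finset α) (t : Finset β) (g : α → β)
    (hg : Function.Injective g) :
    ∑ x ∈ s, (if g x ∈ t then (1 : ℝ) else 0) ≤ t.card := by
  rw [Finset.sum_boole]
  refine Nat.cast_le.2 (Finset.card_le_card_of_injOn g ?_ hg.injOn)
  intro x hx
  exact (Finset.mem_filter.1 hx).2

theorem eq_or_lt_of_sq_add_sq_eq {a b c d : ℕ} (h : a ^ 2 + b ^ 2 = c ^ 2 + d ^ 2) :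
    (c = a ∧ d = b) ∨ (c = b ∧ d = a) ∨ (c < a ∧ d < a) ∨ (c < b ∧ d < b) ∨ (a < c ∧ b < c) ∨
      (a < d ∧ b < d) := by
  have mono : ∀ {x y : ℕ}, x < y → x ^ 2 < y ^ 2 := fun hxy => Nat.pow_lt_pow_left hxy (by norm_num)
  have inj : ∀ {x y : ℕ}, x ^ 2 = y ^ 2 → x = y := fun hxy => Nat.pow_left_injective (n := 2)
    (by norm_num) hxy
  rcases lt_trichotomy c a with hca | rfl | hca
  · have hbd : b < d := by
      by_contra! hcon
      have := mono hca
      have := Nat.pow_le_pow_left hcon 2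
      omega
    rcases lt_trichotomy d a with hda | rfl | hda
    · tauto
    · exact Or.inr (Or.inl ⟨inj (by omega), rfl⟩)
    · tauto
  · exact Or.inl ⟨rfl, inj (by omega)⟩
  · have hbd : d < b := by
      by_contra! hcon
      have := mono hca
      have := Nat.pow_le_pow_left hcon 2
      omega
    rcases lt_trichotomy c b with hcb | rfl | hcb
    · tauto
    · exact Or.inr (Or.inl ⟨rfl, inj (by omega)⟩)
    · tauto

theorem logEnergy_le_add (P : Finset ℕ) (N : ℕ) (r : ℝ)
    (hP : ∀ p ∈ P, p.Prime ∧ Nat.sqrt N < p ∧ p ≤ N) (hr : ∀ p ∈ P, Real.log p ≤ r) :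
    logEnergy P ≤ 2 * (∑ p ∈ P, Real.log p ^ 2) ^ 2 + 4 * r ^ 4 * (primeQuadruples N).card := by
  set Q := primeQuadruples N with hQ
  set W : (ℕ × ℕ) × ℕ × ℕ → ℝ := fun z =>
    (Real.log z.1.1 * Real.log z.1.2) * (Real.log z.2.1 * Real.log z.2.2) with hW
  have hlog : ∀ n : ℕ, 0 ≤ Real.log n := fun n => Real.log_natCast_nonneg n
  have hW0 : ∀ z, 0 ≤ W z := fun z => by
    have := hlog z.1.1; have := hlog z.1.2; have := hlog z.2.1; have := hlog z.2.2
    positivity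
  set S := (P ×ˢ P) ×ˢ (P ×ˢ P) with hS
  have hr4 : 0 ≤ r ^ 4 := by positivity
  have hpt : ∀ z ∈ S, (if z.1.1 ^ 2 + z.1.2 ^ 2 = z.2.1 ^ 2 + z.2.2 ^ 2 then W z else 0) ≤
      (if z.2 = z.1 then W z else 0) + (if z.2 = z.1.swap then W z else 0) +
      r ^ 4 * ((if (z.1.1, z.1.2, z.2.1, z.2.2) ∈ Q then (1 : ℝ) else 0) +
        (if (z.1.2, z.1.1, z.2.1, z.2.2) ∈ Q then (1 : ℝ) else 0) +
        (if (z.2.1, z.2.2, z.1.1, z.1.2) ∈ Q then (1 : ℝ) else 0) +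
        (if (z.2.2, z.2.1, z.1.1, z.1.2) ∈ Q then (1 : ℝ) else 0)) := by
    rintro ⟨⟨a, b⟩, c, d⟩ hz
    simp only [hS, Finset.mem_product] at hz
    obtain ⟨⟨ha, hb⟩, hc, hd⟩ := hz
    have hWz := hW0 ((a, b), c, d)
    have hWr : W ((a, b), c, d) ≤ r ^ 4 := by
      have h1 := mul_le_mul (hr a ha) (hr b hb) (hlog b) ((hlog a).trans (hr a ha))
      have h2 := mul_le_mul (hr c hc) (hr d hd) (hlog d) ((hlog c).trans (hr c hc))
      have h3 := mul_le_mul h1 h2 (mul_nonneg (hlog c) (hlog d)) (mul_self_nonneg r)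
      calc W ((a, b), c, d) ≤ r * r * (r * r) := h3
        _ = r ^ 4 := by ring
    have hmem : ∀ {a b c d : ℕ}, a ∈ P → b ∈ P → c ∈ P → d ∈ P → a ^ 2 + b ^ 2 = c ^ 2 + d ^ 2 →
        c < a → d < a → (a, b, c, d) ∈ Q := by
      intro a b c d ha hb hc hd h h1 h2
      have := hP a ha; have := hP b hb; have := hP c hc; have := hP d hd
      simp only [hQ, primeQuadruples, Finset.mem_filter, Finset.mem_product, Finset.mem_range,
        Nat.lt_succ_iff]
      tauto
    have hi1 : (0 : ℝ) ≤ if (a, b, c, d) ∈ Q then (1 : ℝ) else 0 := by split_ifs <;> norm_num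
    have hi2 : (0 : ℝ) ≤ if (b, a, c, d) ∈ Q then (1 : ℝ) else 0 := by split_ifs <;> norm_num
    have hi3 : (0 : ℝ) ≤ if (c, d, a, b) ∈ Q then (1 : ℝ) else 0 := by split_ifs <;> norm_num
    have hi4 : (0 : ℝ) ≤ if (d, c, a, b) ∈ Q then (1 : ℝ) else 0 := by split_ifs <;> norm_num
    have hj1 : (0 : ℝ) ≤ if (c, d) = (a, b) then W ((a, b), c, d) else 0 := by
      split_ifs <;> [exact hWz; rfl]
    have hj2 : (0 : ℝ) ≤ if (c, d) = (a, b).swap then W ((a, b), c, d) else 0 := by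
      split_ifs <;> [exact hWz; rfl]
    dsimp only
    by_cases h : a ^ 2 + b ^ 2 = c ^ 2 + d ^ 2
    · rw [if_pos h]
      rcases eq_or_lt_of_sq_add_sq_eq h with ⟨rfl, rfl⟩ | ⟨rfl, rfl⟩ | h1 | h1 | h1 | h1
      · rw [if_pos rfl] at hj1 ⊢
        have := mul_nonneg hr4 (add_nonneg (add_nonneg (add_nonneg hi1 hi2) hi3) hi4)
        linarith
      · rw [if_pos (show (c, d) = (d, c).swap from rfl)] at hj2 ⊢
        have := mul_nonneg hr4 (add_nonneg (add_nonneg (add_nonneg hi1 hi2) hi3) hi4)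
        linarith
      · rw [if_pos (hmem ha hb hc hd h h1.1 h1.2)]
        nlinarith
      · rw [if_pos (hmem hb ha hc hd (by omega) h1.1 h1.2)]
        nlinarith
      · rw [if_pos (hmem hc hd ha hb h.symm h1.1 h1.2)]
        nlinarith
      · rw [if_pos (hmem hd hc ha hb (by omega) h1.1 h1.2)]
        nlinarith
    · rw [if_neg h]
      have := mul_nonneg hr4 (add_nonneg (add_nonneg (add_nonneg hi1 hi2) hi3) hi4)
      linarith
  have hE : logEnergy P = ∑ z ∈ S, if z.1.1 ^ 2 + z.1.2 ^ 2 = z.2.1 ^ 2 + z.2.2 ^ 2 then W z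
      else 0 := by
    rw [logEnergy, hS, Finset.sum_product (s := P ×ˢ P) (t := P ×ˢ P)]
  have hsq : ∑ x ∈ P ×ˢ P, Real.log x.1 ^ 2 * Real.log x.2 ^ 2 = (∑ p ∈ P, Real.log p ^ 2) ^ 2 := by
    rw [sq (∑ p ∈ P, Real.log p ^ 2), Finset.sum_mul_sum, Finset.sum_product]
  have hd1 : ∑ z ∈ S, (if z.2 = z.1 then W z else 0) = (∑ p ∈ P, Real.log p ^ 2) ^ 2 := by
    rw [hS, Finset.sum_product (s := P ×ˢ P) (t := P ×ˢ P), ← hsq]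
    refine Finset.sum_congr rfl fun x hx => ?_
    dsimp only
    rw [Finset.sum_ite_eq' (P ×ˢ P) x, if_pos hx]
    simp only [hW]
    ring
  have hd2 : ∑ z ∈ S, (if z.2 = z.1.swap then W z else 0) = (∑ p ∈ P, Real.log p ^ 2) ^ 2 := by
    rw [hS, Finset.sum_product (s := P ×ˢ P) (t := P ×ˢ P), ← hsq]
    refine Finset.sum_congr rfl fun x hx => ?_
    dsimp only
    have hx' : x.swap ∈ P ×ˢ P := by
      simp only [Finset.mem_product, Prod.fst_swap, Prod.snd_swap] at hx ⊢
      tauto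
    rw [Finset.sum_ite_eq' (P ×ˢ P) x.swap, if_pos hx']
    simp only [hW, Prod.fst_swap, Prod.snd_swap]
    ring
  have hinj : ∀ g : (ℕ × ℕ) × ℕ × ℕ → ℕ × ℕ × ℕ × ℕ, Function.Injective g →
      ∑ z ∈ S, (if g z ∈ Q then (1 : ℝ) else 0) ≤ Q.card := fun g hg => sum_ite_mem_le_card S Q g hg
  have i1 := hinj (fun z => (z.1.1, z.1.2, z.2.1, z.2.2)) (by
    rintro ⟨⟨a, b⟩, c, d⟩ ⟨⟨a', b'⟩, c', d'⟩ h
    simp only [Prod.mk.injEq] at h ⊢; tauto)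
  have i2 := hinj (fun z => (z.1.2, z.1.1, z.2.1, z.2.2)) (by
    rintro ⟨⟨a, b⟩, c, d⟩ ⟨⟨a', b'⟩, c', d'⟩ h
    simp only [Prod.mk.injEq] at h ⊢; tauto)
  have i3 := hinj (fun z => (z.2.1, z.2.2, z.1.1, z.1.2)) (by
    rintro ⟨⟨a, b⟩, c, d⟩ ⟨⟨a', b'⟩, c', d'⟩ h
    simp only [Prod.mk.injEq] at h ⊢; tauto)
  have i4 := hinj (fun z => (z.2.2, z.2.1, z.1.1, z.1.2)) (by
    rintro ⟨⟨a, b⟩, c, d⟩ ⟨⟨a', b'⟩, c', d'⟩ h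
    simp only [Prod.mk.injEq] at h ⊢; tauto)
  rw [hE]
  refine (Finset.sum_le_sum hpt).trans ?_
  rw [Finset.sum_add_distrib, Finset.sum_add_distrib, hd1, hd2, ← Finset.mul_sum,
    Finset.sum_add_distrib, Finset.sum_add_distrib, Finset.sum_add_distrib]
  have := mul_le_mul_of_nonneg_left (add_le_add (add_le_add (add_le_add i1 i2) i3) i4) hr4
  linarith

theorem logEnergy_le_of_forall_mem_le (P : Finset ℕ) (B r : ℝ) (hB : (P.card : ℝ) ≤ B)
    (hr : ∀ p ∈ P, Real.log p ≤ r) : logEnergy P ≤ B ^ 4 * r ^ 4 := by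
  have hlog : ∀ n : ℕ, 0 ≤ Real.log n := fun n => Real.log_natCast_nonneg n
  have hterm : ∀ x ∈ P ×ˢ P, ∀ y ∈ P ×ˢ P, (if x.1 ^ 2 + x.2 ^ 2 = y.1 ^ 2 + y.2 ^ 2 then
    (Real.log x.1 * Real.log x.2) * (Real.log y.1 * Real.log y.2) else 0) ≤ r ^ 4 := by
    rintro ⟨a, b⟩ hx ⟨c, d⟩ hy
    rw [Finset.mem_product] at hx hy
    split_ifs
    · have h1 := mul_le_mul (hr a hx.1) (hr b hx.2) (hlog b) ((hlog a).trans (hr a hx.1))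
      have h2 := mul_le_mul (hr c hy.1) (hr d hy.2) (hlog d) ((hlog c).trans (hr c hy.1))
      have h3 := mul_le_mul h1 h2 (mul_nonneg (hlog c) (hlog d)) (mul_self_nonneg r)
      refine h3.trans (le_of_eq ?_)
      ring
    · positivity
  have h1 : logEnergy P ≤ (P.card : ℝ) ^ 4 * r ^ 4 := by
    rw [logEnergy]
    refine (Finset.sum_le_card_nsmul _ _ _ fun x hx =>
      Finset.sum_le_card_nsmul _ _ _ (hterm x hx)).trans (le_of_eq ?_)
    simp only [Finset.card_product, nsmul_eq_mul]
    push_cast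
    ring
  exact h1.trans (by gcongr)

theorem exists_logEnergy_le (δ : ℝ) (hδ : 0 < δ) : ∃ C > 0, ∀ X ≥ (2 : ℝ), ∀ P : Finset ℕ,
    (∀ p ∈ P, p.Prime ∧ δ * X ≤ (p : ℝ) ^ 2 ∧ (p : ℝ) ^ 2 ≤ X) →
    logEnergy P ≤ C * X * Real.log X ^ 2 := by
  obtain ⟨C, hC, hQ⟩ := exists_card_primeQuadruples_le
  refine ⟨(2 * Real.log 4 ^ 2 + 4 * C) + (1 / δ ^ 2 + 1) ^ 6, by positivity, ?_⟩
  intro X hX P hP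
  have hX0 : (0 : ℝ) < X := by linarith
  have hsqX : 1 ≤ Real.sqrt X := Real.one_le_sqrt.2 (by linarith)
  obtain ⟨N, hN⟩ : ∃ N, N = ⌊Real.sqrt X⌋₊ := ⟨_, rfl⟩
  have hN1 : 1 ≤ N := by rw [hN]; exact Nat.le_floor (by exact_mod_cast hsqX)
  have hNX : (N : ℝ) ≤ Real.sqrt X := by rw [hN]; exact Nat.floor_le (by positivity)
  have hN2 : (N : ℝ) ^ 2 ≤ X := by
    calc (N : ℝ) ^ 2 ≤ Real.sqrt X ^ 2 := by gcongr
      _ = X := Real.sq_sqrt hX0.le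
  have hpN : ∀ p ∈ P, p ≤ N := fun p hp => by
    rw [hN]
    exact Nat.le_floor (Real.le_sqrt_of_sq_le (hP p hp).2.2)
  have hN0 : (0 : ℝ) < N := by exact_mod_cast hN1
  have hlogp : ∀ p ∈ P, Real.log p ≤ Real.log N := fun p hp =>
    Real.log_le_log (by exact_mod_cast (hP p hp).1.pos) (by exact_mod_cast hpN p hp)
  have hlogN0 : 0 ≤ Real.log N := Real.log_natCast_nonneg N
  have hlogNX : Real.log N ≤ Real.log X := Real.log_le_log hN0 (by
    have : (1 : ℝ) ≤ N := by exact_mod_cast hN1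
    nlinarith)
  have hlogX0 : 0 ≤ Real.log X := hlogN0.trans hlogNX
  by_cases hbig : 1 / δ ^ 2 < X
  · have hlow : ∀ p ∈ P, p.Prime ∧ Nat.sqrt N < p ∧ p ≤ N := by
      intro p hp
      refine ⟨(hP p hp).1, ?_, hpN p hp⟩
      rw [Nat.sqrt_lt]
      have h1 : Real.sqrt X < δ * X := by
        rw [Real.sqrt_lt' (by positivity)]
        rw [div_lt_iff₀ (by positivity)] at hbig
        nlinarith
      have h2 : (N : ℝ) < (p : ℝ) ^ 2 := by linarith [(hP p hp).2.1]
      rw [← sq]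
      exact_mod_cast h2
    have h1 := logEnergy_le_add P N (Real.log N) hlow hlogp
    have hth : ∑ p ∈ P, Real.log p ≤ Real.log 4 * N := by
      refine le_trans ?_ (Chebyshev.theta_le_log4_mul_x (x := N) hN0.le)
      rw [Chebyshev.theta]
      refine Finset.sum_le_sum_of_subset_of_nonneg ?_ fun p _ _ => Real.log_natCast_nonneg p
      intro p hp
      rw [Finset.mem_filter, Finset.mem_Ioc, Nat.floor_natCast]
      exact ⟨⟨(hP p hp).1.pos, hpN p hp⟩, (hP p hp).1⟩
    have hth2 : ∑ p ∈ P, Real.log p ^ 2 ≤ Real.log N * (Real.log 4 * N) := by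
      calc ∑ p ∈ P, Real.log p ^ 2 ≤ ∑ p ∈ P, Real.log N * Real.log p := by
            refine Finset.sum_le_sum fun p hp => ?_
            rw [sq]
            exact mul_le_mul_of_nonneg_right (hlogp p hp) (Real.log_natCast_nonneg p)
        _ = Real.log N * ∑ p ∈ P, Real.log p := by rw [Finset.mul_sum]
        _ ≤ _ := by gcongr
    have hlogm : Real.log N ≤ ((Nat.log 2 N + 1 : ℕ) : ℝ) := by
      have h2 : (N : ℝ) ≤ 2 ^ (Nat.log 2 N + 1) := by
        exact_mod_cast (Nat.lt_pow_succ_log_self (by norm_num) N).le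
      have h3 := Real.log_le_log hN0 h2
      rw [Real.log_pow] at h3
      have := Real.log_two_lt_d9
      have h4 : (0 : ℝ) ≤ ((Nat.log 2 N + 1 : ℕ) : ℝ) := by positivity
      nlinarith
    have hq := hQ N hN1
    have hmpos : (0 : ℝ) < ((Nat.log 2 N + 1 : ℕ) : ℝ) := by positivity
    generalize ((Nat.log 2 N + 1 : ℕ) : ℝ) = m at hlogm hq hmpos
    have hq2 : Real.log N ^ 2 * (primeQuadruples N).card ≤ C * N ^ 2 := by
      calc Real.log N ^ 2 * (primeQuadruples N).card ≤ m ^ 2 * (C * N ^ 2 / m ^ 2) := by gcongr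
        _ = C * N ^ 2 := by field_simp
    calc logEnergy P ≤ 2 * (∑ p ∈ P, Real.log p ^ 2) ^ 2 +
          4 * Real.log N ^ 4 * (primeQuadruples N).card := h1
      _ = 2 * (∑ p ∈ P, Real.log p ^ 2) ^ 2 +
          4 * Real.log N ^ 2 * (Real.log N ^ 2 * (primeQuadruples N).card) := by ring
      _ ≤ 2 * (Real.log N * (Real.log 4 * N)) ^ 2 + 4 * Real.log N ^ 2 * (C * N ^ 2) := by
          gcongr
      _ = (2 * Real.log 4 ^ 2 + 4 * C) * N ^ 2 * Real.log N ^ 2 := by ring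
      _ ≤ (2 * Real.log 4 ^ 2 + 4 * C) * X * Real.log X ^ 2 := by gcongr
      _ ≤ _ := by
          refine mul_le_mul_of_nonneg_right (mul_le_mul_of_nonneg_right ?_ hX0.le) (sq_nonneg _)
          have : 0 ≤ (1 / δ ^ 2 + 1) ^ 6 := by positivity
          linarith
  · push Not at hbig
    have hcard : (P.card : ℝ) ≤ 1 / δ ^ 2 + 1 := by
      have h1 : P ⊆ Finset.range (N + 1) := fun p hp =>
        Finset.mem_range.2 (Nat.lt_succ_of_le (hpN p hp))
      have h2 := Finset.card_le_card h1
      rw [Finset.card_range] at h2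
      have h3 : (P.card : ℝ) ≤ N + 1 := by exact_mod_cast h2
      have h4 : (N : ℝ) ≤ X := by
        have : (1 : ℝ) ≤ N := by exact_mod_cast hN1
        nlinarith
      linarith
    have h1 := logEnergy_le_of_forall_mem_le P _ _ hcard hlogp
    have hlX : Real.log X ≤ 1 / δ ^ 2 + 1 := by
      have := Real.log_le_sub_one_of_pos hX0
      linarith
    calc logEnergy P ≤ (1 / δ ^ 2 + 1) ^ 4 * Real.log N ^ 4 := h1
      _ ≤ (1 / δ ^ 2 + 1) ^ 4 * Real.log X ^ 4 := by gcongr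
      _ = (1 / δ ^ 2 + 1) ^ 4 * Real.log X ^ 2 * Real.log X ^ 2 := by ring
      _ ≤ (1 / δ ^ 2 + 1) ^ 4 * (1 / δ ^ 2 + 1) ^ 2 * Real.log X ^ 2 := by gcongr
      _ = (1 / δ ^ 2 + 1) ^ 6 * 1 * Real.log X ^ 2 := by ring
      _ ≤ (1 / δ ^ 2 + 1) ^ 6 * X * Real.log X ^ 2 := by gcongr; linarith
      _ ≤ _ := by
          refine mul_le_mul_of_nonneg_right (mul_le_mul_of_nonneg_right ?_ hX0.le) (sq_nonneg _)
          have : 0 ≤ 2 * Real.log 4 ^ 2 + 4 * C := by positivity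
          linarith

theorem e_add (x y : ℝ) : e (x + y) = e x * e y := by
  rw [e, e, e, ← Complex.exp_add]
  push_cast
  ring_nf

theorem norm_e (x : ℝ) : ‖e x‖ = 1 := by
  rw [e, show 2 * (Real.pi : ℂ) * Complex.I * x = ((2 * Real.pi * x : ℝ) : ℂ) * Complex.I by
    push_cast; ring]
  exact Complex.norm_exp_ofReal_mul_I _

theorem conj_e (x : ℝ) : (starRingEnd ℂ) (e x) = e (-x) := by
  rw [e, e, ← Complex.exp_conj]
  congr 1
  simp only [map_mul, Complex.conj_ofReal, Complex.conj_I, map_ofNat]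
  push_cast
  ring

theorem e_intCast (n : ℤ) : e n = 1 := by
  rw [e, Complex.exp_eq_one_iff]
  exact ⟨n, by push_cast; ring⟩

theorem continuous_e : Continuous e := by
  unfold e
  fun_prop

theorem integral_e_mul {θ : ℝ} (hθ : θ ≠ 0) (a b : ℝ) :
    ∫ x in a..b, e (θ * x) = (e (θ * b) - e (θ * a)) / (2 * Real.pi * Complex.I * θ) := by
  have hc : 2 * (Real.pi : ℂ) * Complex.I * θ ≠ 0 := by
    simp [Real.pi_ne_zero, hθ]
  have h := integral_exp_mul_complex (a := a) (b := b) hc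
  simp only [e]
  push_cast
  simp only [← mul_assoc]
  exact h

theorem integral_e_eq_zero {θ h : ℝ} (hθ : θ ≠ 0) {n : ℤ} (hn : θ * h = n) (a : ℝ) :
    ∫ x in a..a + h, e (θ * x) = 0 := by
  rw [integral_e_mul hθ, mul_add, e_add, hn, e_intCast, mul_one, sub_self, zero_div]

theorem norm_integral_e_le_length (θ a h : ℝ) (hh : 0 ≤ h) :
    ‖∫ x in a..a + h, e (θ * x)‖ ≤ h := by
  refine (intervalIntegral.norm_integral_le_of_norm_le_const (C := 1)
    fun x _ => (norm_e _).le).trans ?_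
  rw [add_sub_cancel_left, abs_of_nonneg hh, one_mul]

theorem norm_integral_e_le_inv {θ : ℝ} (hθ : θ ≠ 0) (a b : ℝ) :
    ‖∫ x in a..b, e (θ * x)‖ ≤ |θ|⁻¹ := by
  have hθ' : 0 < |θ| := abs_pos.2 hθ
  rw [integral_e_mul hθ, norm_div]
  have h1 : ‖e (θ * b) - e (θ * a)‖ ≤ 2 := by
    refine (norm_sub_le _ _).trans ?_
    rw [norm_e, norm_e]
    norm_num
  have h2 : ‖2 * (Real.pi : ℂ) * Complex.I * θ‖ = 2 * Real.pi * |θ| := by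
    simp [abs_of_pos Real.pi_pos]
  rw [h2, div_le_iff₀ (by positivity)]
  have h3 : |θ|⁻¹ * (2 * Real.pi * |θ|) = 2 * Real.pi := by field_simp
  rw [h3]
  linarith [Real.pi_gt_three]

theorem integral_norm_sq_expSum_le {ι : Type*} (I : Finset ι) (c : ι → ℝ) (ν : ι → ℝ)
    (hc : ∀ i ∈ I, 0 ≤ c i) (a b : ℝ) :
    ∫ x in a..b, ‖∑ i ∈ I, (c i : ℂ) * e (ν i * x)‖ ^ 2 ≤
      ∑ i ∈ I, ∑ j ∈ I, c i * c j * ‖∫ x in a..b, e ((ν i - ν j) * x)‖ := by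
  have hpt : ∀ x : ℝ, ((‖∑ i ∈ I, (c i : ℂ) * e (ν i * x)‖ ^ 2 : ℝ) : ℂ) =
      ∑ i ∈ I, ∑ j ∈ I, (c i * c j : ℂ) * e ((ν i - ν j) * x) := by
    intro x
    rw [Complex.ofReal_pow, ← Complex.mul_conj', map_sum, Finset.sum_mul_sum]
    refine Finset.sum_congr rfl fun i _ => Finset.sum_congr rfl fun j _ => ?_
    rw [map_mul, Complex.conj_ofReal, conj_e, sub_mul, sub_eq_add_neg, e_add]
    ring
  have hcont : ∀ θ : ℝ, Continuous fun x : ℝ => e (θ * x) := fun θ =>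
    continuous_e.comp (continuous_const.mul continuous_id)
  have hint : ((∫ x in a..b, ‖∑ i ∈ I, (c i : ℂ) * e (ν i * x)‖ ^ 2 : ℝ) : ℂ) =
      ∑ i ∈ I, ∑ j ∈ I, (c i * c j : ℂ) * ∫ x in a..b, e ((ν i - ν j) * x) := by
    rw [← intervalIntegral.integral_ofReal]
    simp only [hpt]
    rw [intervalIntegral.integral_finsetSum]
    · refine Finset.sum_congr rfl fun i _ => ?_
      rw [intervalIntegral.integral_finsetSum]
      · refine Finset.sum_congr rfl fun j _ => ?_
        rw [intervalIntegral.integral_const_mul]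
      · exact fun j _ => (continuous_const.mul (hcont _)).intervalIntegrable _ _
    · exact fun i _ => (continuous_finsetSum _ fun j _ =>
        continuous_const.mul (hcont _)).intervalIntegrable _ _
  refine (le_abs_self _).trans ?_
  rw [← Real.norm_eq_abs, ← Complex.norm_real, hint]
  refine (norm_sum_le _ _).trans (Finset.sum_le_sum fun i hi =>
    (norm_sum_le _ _).trans (Finset.sum_le_sum fun j hj => ?_))
  rw [norm_mul, norm_mul, Complex.norm_real, Complex.norm_real, Real.norm_of_nonneg (hc i hi),
    Real.norm_of_nonneg (hc j hj)]

/-- A function that is bounded on average over intervals of length `h` has a tail integral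
against `α⁻²` of the expected size. -/
theorem integral_Ioi_mul_inv_sq_le {f : ℝ → ℝ} (hf : Continuous f) (hf0 : ∀ x, 0 ≤ f x) {h B R : ℝ}
    (hh : 0 < h) (hB : ∀ a, ∫ x in a..a + h, f x ≤ h * B) (hR : 2 * h ≤ R) :
    ∫ x in Set.Ioi R, f x * (x ^ 2)⁻¹ ≤ 2 * B / R := by
  have hR0 : 0 < R := by linarith
  have hB0 : 0 ≤ B := by
    have h1 : 0 ≤ ∫ x in (0 : ℝ)..0 + h, f x :=
      intervalIntegral.integral_nonneg (by linarith) fun x _ => hf0 x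
    exact nonneg_of_mul_nonneg_right (h1.trans (hB 0)) hh
  by_cases hint : IntegrableOn (fun x => f x * (x ^ 2)⁻¹) (Set.Ioi R)
  swap
  · rw [integral_undef hint]
    positivity
  have hii : ∀ a b : ℝ, 0 < a → 0 < b →
      IntervalIntegrable (fun x => f x * (x ^ 2)⁻¹) volume a b := by
    intro a b ha hb
    refine ContinuousOn.intervalIntegrable (hf.continuousOn.mul (ContinuousOn.inv₀ (by fun_prop) ?_))
    intro x hx
    have : 0 < x := (lt_min ha hb).trans_le hx.1
    positivity
  have hstep : ∀ a, R ≤ a → ∫ x in a..a + h, f x * (x ^ 2)⁻¹ ≤ B * (1 / (a - h) - 1 / a) := by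
    intro a ha
    have ha0 : 0 < a := by linarith
    have hah : 0 < a - h := by linarith
    calc ∫ x in a..a + h, f x * (x ^ 2)⁻¹ ≤ ∫ x in a..a + h, f x * (a ^ 2)⁻¹ := by
          refine intervalIntegral.integral_mono_on (by linarith) (hii _ _ ha0 (by linarith))
            ((hf.mul continuous_const).intervalIntegrable _ _) fun x hx => ?_
          have := hf0 x
          have := hx.1
          gcongr
      _ = (∫ x in a..a + h, f x) * (a ^ 2)⁻¹ := intervalIntegral.integral_mul_const _ _
      _ ≤ h * B * (a ^ 2)⁻¹ := by gcongr; exact hB a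
      _ ≤ h * B * (a * (a - h))⁻¹ := by
          gcongr
          nlinarith
      _ = _ := by field_simp; ring
  have hpart : ∀ n : ℕ, ∫ x in R..R + n * h, f x * (x ^ 2)⁻¹ ≤
      B * (1 / (R - h) - 1 / (R + n * h - h)) := by
    intro n
    induction n with
    | zero => simp
    | succ n ih =>
      have hn : 0 ≤ (n : ℝ) * h := by positivity
      have e1 : R + ((n + 1 : ℕ) : ℝ) * h = R + n * h + h := by push_cast; ring
      rw [e1, ← intervalIntegral.integral_add_adjacent_intervals (b := R + n * h)
        (hii _ _ hR0 (by linarith)) (hii _ _ (by linarith) (by linarith)), add_sub_cancel_right]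
      have := hstep (R + n * h) (by linarith)
      have e2 : B * (1 / (R - h) - 1 / (R + n * h)) = B * (1 / (R - h) - 1 / (R + n * h - h)) +
        B * (1 / (R + n * h - h) - 1 / (R + n * h)) := by ring
      linarith
  have htend : Filter.Tendsto (fun n : ℕ => R + n * h) Filter.atTop Filter.atTop :=
    Filter.tendsto_atTop_add_const_left _ _
      (tendsto_natCast_atTop_atTop.atTop_mul_const hh)
  have hlim := intervalIntegral_tendsto_integral_Ioi R hint htend
  refine le_of_tendsto' hlim fun n => (hpart n).trans ?_
  have hn : 0 ≤ (n : ℝ) * h := by positivity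
  calc B * (1 / (R - h) - 1 / (R + n * h - h)) ≤ B * (1 / (R / 2)) := by
        have h1 : 0 ≤ 1 / (R + n * h - h) := one_div_nonneg.2 (by linarith)
        have h2 : 1 / (R - h) ≤ 1 / (R / 2) := one_div_le_one_div_of_le (by linarith) (by linarith)
        gcongr
        linarith
    _ = 2 * B / R := by field_simp

theorem abs_sub_le_abs_rpow_sub_rpow {k : ℝ} (hk : 1 < k) {p q : ℕ} (hp : 1 ≤ p) (hq : 1 ≤ q) :
    |(p : ℝ) - q| ≤ |(p : ℝ) ^ k - (q : ℝ) ^ k| := by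
  have key : ∀ x y : ℝ, 1 ≤ x → x ≤ y → y - x ≤ y ^ k - x ^ k := by
    intro x y hx hxy
    have h1 : 1 ≤ x ^ (k - 1) := Real.one_le_rpow hx (by linarith)
    have h2 : x ^ (k - 1) ≤ y ^ (k - 1) := Real.rpow_le_rpow (by linarith) hxy (by linarith)
    have h3 : ∀ z : ℝ, 1 ≤ z → z ^ k = z * z ^ (k - 1) := fun z hz => by
      rw [Real.rpow_sub_one (by linarith)]
      field_simp
    rw [h3 x hx, h3 y (hx.trans hxy)]
    nlinarith
  have hp' : (1 : ℝ) ≤ p := by exact_mod_cast hp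
  have hq' : (1 : ℝ) ≤ q := by exact_mod_cast hq
  rcases le_total (p : ℝ) q with h | h
  · have := key p q hp' h
    rw [abs_sub_comm (p : ℝ), abs_sub_comm ((p : ℝ) ^ k), abs_of_nonneg (by linarith),
      abs_of_nonneg (by linarith)]
    exact this
  · have := key q p hq' h
    rw [abs_of_nonneg (by linarith), abs_of_nonneg (by linarith)]
    exact this

theorem sum_inv_dist_le (n p : ℕ) (hp : p ∈ Finset.Icc 1 n) :
    ∑ q ∈ Finset.Icc 1 n, (if p = q then (1 : ℝ) else |(p : ℝ) - q|⁻¹) ≤ 3 + 2 * Real.log n := by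
  have hpt : ∀ q ∈ Finset.Icc 1 n, (if p = q then (1 : ℝ) else |(p : ℝ) - q|⁻¹) ≤
      (if p = q then 1 else 0) + ∑ d ∈ Finset.Icc 1 n, (d : ℝ)⁻¹ *
        ((if q = p - d then 1 else 0) + (if q = p + d then 1 else 0)) := by
    intro q hq
    rw [Finset.mem_Icc] at hp hq
    have hnn : ∀ d ∈ Finset.Icc 1 n, (0 : ℝ) ≤ (d : ℝ)⁻¹ *
        ((if q = p - d then 1 else 0) + (if q = p + d then 1 else 0)) := by
      intro d _
      refine mul_nonneg (by positivity) (add_nonneg ?_ ?_) <;> split_ifs <;> norm_num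
    rcases lt_trichotomy p q with h | h | h
    · rw [if_neg h.ne, if_neg h.ne, zero_add]
      refine le_trans (le_of_eq ?_) (Finset.single_le_sum hnn
        (Finset.mem_Icc.2 ⟨by omega, by omega⟩ : q - p ∈ Finset.Icc 1 n))
      rw [if_neg (by omega), if_pos (by omega), Nat.cast_sub h.le, abs_sub_comm, abs_of_nonneg]
      · ring
      · rw [sub_nonneg]; exact_mod_cast h.le
    · rw [if_pos h, if_pos h]
      have := Finset.sum_nonneg hnn
      linarith
    · rw [if_neg h.ne', if_neg h.ne', zero_add]
      refine le_trans (le_of_eq ?_) (Finset.single_le_sum hnn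
        (Finset.mem_Icc.2 ⟨by omega, by omega⟩ : p - q ∈ Finset.Icc 1 n))
      rw [if_pos (by omega), if_neg (by omega), Nat.cast_sub h.le, abs_of_nonneg]
      · ring
      · rw [sub_nonneg]; exact_mod_cast h.le
  refine (Finset.sum_le_sum hpt).trans ?_
  rw [Finset.sum_add_distrib, Finset.sum_ite_eq, if_pos hp, Finset.sum_comm]
  have hd : ∀ d ∈ Finset.Icc 1 n, ∑ q ∈ Finset.Icc 1 n, (d : ℝ)⁻¹ *
      ((if q = p - d then 1 else 0) + (if q = p + d then 1 else 0)) ≤ 2 * (d : ℝ)⁻¹ := by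
    intro d _
    rw [← Finset.mul_sum, Finset.sum_add_distrib, Finset.sum_ite_eq', Finset.sum_ite_eq', mul_comm]
    gcongr
    split_ifs <;> norm_num
  have hharm := harmonic_le_one_add_log n
  rw [harmonic_eq_sum_Icc] at hharm
  push_cast at hharm
  have := Finset.sum_le_sum hd
  rw [← Finset.mul_sum] at this
  linarith

theorem integral_norm_sq_powers_le (k l h X : ℝ) (hk : 1 < k) (hl : l ≠ 0) (hh : h = 1 / |l|)
    (hX : 2 ≤ X) (P : Finset ℕ) (hP : ∀ p ∈ P, 1 ≤ p ∧ (p : ℝ) ^ k ≤ X) (a : ℝ) :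
    ∫ α in a..a + h, ‖∑ p ∈ P, (Real.log p : ℂ) * e ((p : ℝ) ^ k * (l * α))‖ ^ 2 ≤
      h * (7 * X ^ (1 / k) * Real.log X ^ 3) := by
  have hl0 : 0 < |l| := abs_pos.2 hl
  have hh0 : 0 < h := by rw [hh]; positivity
  have hX0 : 0 < X := by linarith
  have hlogX : Real.log 2 ≤ Real.log X := Real.log_le_log (by norm_num) hX
  have hlog2 := Real.log_two_gt_d9
  have hlX : 0 < Real.log X := by linarith
  obtain ⟨n, hn⟩ : ∃ n, n = ⌊X ^ (1 / k)⌋₊ := ⟨_, rfl⟩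
  have hY1 : 1 ≤ X ^ (1 / k) := Real.one_le_rpow (by linarith) (by positivity)
  have hnY : (n : ℝ) ≤ X ^ (1 / k) := by rw [hn]; exact Nat.floor_le (by positivity)
  have hn1 : (1 : ℝ) ≤ n := by
    have : 1 ≤ n := by rw [hn]; exact Nat.le_floor (by exact_mod_cast hY1)
    exact_mod_cast this
  have hYX : X ^ (1 / k) ≤ X := by
    calc X ^ (1 / k) ≤ X ^ (1 : ℝ) := by
          refine Real.rpow_le_rpow_of_exponent_le (by linarith) ?_
          rw [div_le_one (by linarith)]
          exact hk.le
      _ = X := Real.rpow_one X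
  have hpn : P ⊆ Finset.Icc 1 n := by
    intro p hp
    rw [Finset.mem_Icc, hn]
    refine ⟨(hP p hp).1, Nat.le_floor ?_⟩
    rw [one_div, Real.le_rpow_inv_iff_of_pos (by positivity) hX0.le (by linarith)]
    exact (hP p hp).2
  have hlogn : Real.log n ≤ Real.log X := Real.log_le_log (by linarith) (hnY.trans hYX)
  have hlogp : ∀ p ∈ P, Real.log p ≤ Real.log X := by
    intro p hp
    have h1 := Finset.mem_Icc.1 (hpn hp)
    refine (Real.log_le_log (by exact_mod_cast h1.1) ?_).trans hlogn
    exact_mod_cast h1.2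
  have hlog0 : ∀ p : ℕ, 0 ≤ Real.log p := fun p => Real.log_natCast_nonneg p
  have e1 : ∀ α : ℝ, ∑ p ∈ P, (Real.log p : ℂ) * e ((p : ℝ) ^ k * (l * α)) =
      ∑ p ∈ P, (Real.log p : ℂ) * e ((l * (p : ℝ) ^ k) * α) := fun α =>
    Finset.sum_congr rfl fun p _ => by rw [mul_left_comm, mul_assoc]
  simp only [e1]
  have hpair : ∀ p ∈ P, ∀ q ∈ P, Real.log p * Real.log q *
      ‖∫ x in a..a + h, e ((l * (p : ℝ) ^ k - l * (q : ℝ) ^ k) * x)‖ ≤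
      Real.log X ^ 2 * (h * (if p = q then (1 : ℝ) else |(p : ℝ) - q|⁻¹)) := by
    intro p hp q hq
    rw [sq]
    refine mul_le_mul (mul_le_mul (hlogp p hp) (hlogp q hq) (hlog0 q) hlX.le) ?_
      (norm_nonneg _) (by positivity)
    split_ifs with hpq
    · rw [mul_one]
      exact norm_integral_e_le_length _ _ _ hh0.le
    · have h1 := abs_sub_le_abs_rpow_sub_rpow hk (hP p hp).1 (hP q hq).1
      have h2 : 0 < |(p : ℝ) - q| := by
        rw [abs_pos, sub_ne_zero]
        exact_mod_cast hpq
      have h3 : |l * (p : ℝ) ^ k - l * (q : ℝ) ^ k| = |l| * |(p : ℝ) ^ k - (q : ℝ) ^ k| := by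
        rw [← mul_sub, abs_mul]
      have h4 : l * (p : ℝ) ^ k - l * (q : ℝ) ^ k ≠ 0 := by
        rw [← abs_pos, h3]
        exact mul_pos hl0 (h2.trans_le h1)
      refine (norm_integral_e_le_inv h4 _ _).trans ?_
      rw [h3, mul_inv, hh, one_div]
      gcongr
  refine (integral_norm_sq_expSum_le P _ _ (fun p _ => hlog0 p) _ _).trans ?_
  calc _ ≤ ∑ p ∈ P, ∑ q ∈ P, Real.log X ^ 2 *
          (h * (if p = q then (1 : ℝ) else |(p : ℝ) - q|⁻¹)) :=
        Finset.sum_le_sum fun p hp => Finset.sum_le_sum fun q hq => hpair p hp q hq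
    _ = Real.log X ^ 2 * (h * ∑ p ∈ P, ∑ q ∈ P, (if p = q then (1 : ℝ) else |(p : ℝ) - q|⁻¹)) := by
        simp only [Finset.mul_sum]
    _ ≤ Real.log X ^ 2 * (h * ∑ p ∈ P, (3 + 2 * Real.log n)) := by
        gcongr with p hp
        refine le_trans (Finset.sum_le_sum_of_subset_of_nonneg hpn fun q _ _ => ?_)
          (sum_inv_dist_le n p (hpn hp))
        split_ifs <;> positivity
    _ ≤ Real.log X ^ 2 * (h * (X ^ (1 / k) * (7 * Real.log X))) := by
        rw [Finset.sum_const, nsmul_eq_mul]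
        have hc : (P.card : ℝ) ≤ X ^ (1 / k) := by
          have := Finset.card_le_card hpn
          rw [Nat.card_Icc, Nat.add_sub_cancel] at this
          exact le_trans (by exact_mod_cast this) hnY
        have h0 : 0 ≤ Real.log n := Real.log_natCast_nonneg n
        gcongr
        linarith
    _ = _ := by ring

theorem integral_norm_pow_four_squares_le (l h : ℝ) (hl : l ≠ 0) (hh : h = 1 / |l|)
    (P : Finset ℕ) (a : ℝ) :
    ∫ α in a..a + h, ‖∑ p ∈ P, (Real.log p : ℂ) * e ((p : ℝ) ^ (2 : ℝ) * (l * α))‖ ^ 4 ≤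
      h * logEnergy P := by
  have hl0 : 0 < |l| := abs_pos.2 hl
  have hh0 : 0 < h := by rw [hh]; positivity
  have e1 : ∀ α : ℝ, ‖∑ p ∈ P, (Real.log p : ℂ) * e ((p : ℝ) ^ (2 : ℝ) * (l * α))‖ ^ 4 =
      ‖∑ x ∈ P ×ˢ P, ((Real.log x.1 * Real.log x.2 : ℝ) : ℂ) *
        e ((l * ((x.1 : ℝ) ^ 2 + (x.2 : ℝ) ^ 2)) * α)‖ ^ 2 := by
    intro α
    rw [show 4 = 2 * 2 from rfl, pow_mul, ← norm_pow, sq (∑ p ∈ P, _), Finset.sum_mul_sum,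
      Finset.sum_product]
    congr 2
    refine Finset.sum_congr rfl fun p _ => Finset.sum_congr rfl fun q _ => ?_
    rw [show l * ((p : ℝ) ^ 2 + (q : ℝ) ^ 2) * α = (p : ℝ) ^ (2 : ℝ) * (l * α) +
      (q : ℝ) ^ (2 : ℝ) * (l * α) by rw [Real.rpow_two, Real.rpow_two]; ring, e_add]
    push_cast
    ring
  simp only [e1]
  refine (integral_norm_sq_expSum_le (P ×ˢ P) _ _ (fun x _ => mul_nonneg
    (Real.log_natCast_nonneg _) (Real.log_natCast_nonneg _)) _ _).trans ?_
  rw [logEnergy, Finset.mul_sum]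
  refine Finset.sum_le_sum fun x _ => ?_
  rw [Finset.mul_sum]
  refine Finset.sum_le_sum fun y _ => ?_
  split_ifs with hxy
  · rw [mul_comm h]
    refine mul_le_mul_of_nonneg_left (norm_integral_e_le_length _ _ _ hh0.le) ?_
    have := Real.log_natCast_nonneg x.1
    have := Real.log_natCast_nonneg x.2
    have := Real.log_natCast_nonneg y.1
    have := Real.log_natCast_nonneg y.2
    positivity
  · have hne : ((x.1 : ℝ) ^ 2 + (x.2 : ℝ) ^ 2) - ((y.1 : ℝ) ^ 2 + (y.2 : ℝ) ^ 2) ≠ 0 := by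
      rw [sub_ne_zero]
      exact_mod_cast hxy
    obtain ⟨n, hn⟩ : ∃ n : ℤ, l * h = n := by
      rw [hh]
      rcases abs_choice l with h1 | h1
      · exact ⟨1, by rw [h1]; push_cast; field_simp⟩
      · exact ⟨-1, by rw [h1]; push_cast; field_simp⟩
    rw [integral_e_eq_zero (n := n * (((x.1 : ℤ) ^ 2 + (x.2 : ℤ) ^ 2) -
      ((y.1 : ℤ) ^ 2 + (y.2 : ℤ) ^ 2))), norm_zero, mul_zero, mul_zero]
    · rw [← mul_sub]
      exact mul_ne_zero hl hne
    · push_cast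
      rw [← hn]
      ring

theorem continuous_S (k δ X : ℝ) : Continuous (S k δ X) := by
  unfold S
  exact continuous_finsetSum _ fun p _ => continuous_const.mul
    (continuous_e.comp (continuous_const.mul continuous_id))

theorem statement16 (k δ l l' : ℝ) (hk : 1 < k) (hδ0 : 0 < δ) (hδ1 : δ < 1)
    (hl : l ≠ 0) (hl' : l' ≠ 0) :
    ∃ C > 0, ∀ X ≥ (2 : ℝ), ∀ R : ℝ, max (2 / |l|) (2 / |l'|) ≤ R →
      (∫ α in Set.Ioi R, ‖S 2 δ X (l * α)‖ ^ 4 * (α ^ 2)⁻¹) ≤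
        C * X * (Real.log X) ^ 2 / R ∧
      (∫ α in Set.Ioi R, ‖S k δ X (l' * α)‖ ^ 2 * (α ^ 2)⁻¹) ≤
        C * X ^ (1 / k) * (Real.log X) ^ 3 / R := by
  obtain ⟨C, hC, hE⟩ := exists_logEnergy_le δ hδ0
  refine ⟨2 * C + 14, by positivity, fun X hX R hR => ?_⟩
  have hl0 : 0 < |l| := abs_pos.2 hl
  have hl'0 : 0 < |l'| := abs_pos.2 hl'
  have hX0 : 0 < X := by linarith
  have hlX : 0 ≤ Real.log X := Real.log_nonneg (by linarith)
  have hR1 : 2 * (1 / |l|) ≤ R := by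
    rw [mul_one_div]; exact (le_max_left _ _).trans hR
  have hR2 : 2 * (1 / |l'|) ≤ R := by
    rw [mul_one_div]; exact (le_max_right _ _).trans hR
  have hR0 : 0 < R := lt_of_lt_of_le (by positivity) hR1
  constructor
  · obtain ⟨P, hP⟩ : ∃ P, P = (Finset.range (⌈X⌉₊ + 1)).filter
      (fun p : ℕ => p.Prime ∧ δ * X ≤ (p : ℝ) ^ (2 : ℝ) ∧ (p : ℝ) ^ (2 : ℝ) ≤ X) := ⟨_, rfl⟩
    have h1 := hE X hX P (by
      intro p hp
      rw [hP] at hp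
      have := (Finset.mem_filter.1 hp).2
      rwa [Real.rpow_two] at this)
    have h2 : ∀ a, ∫ α in a..a + 1 / |l|, ‖S 2 δ X (l * α)‖ ^ 4 ≤ 1 / |l| * logEnergy P := by
      intro a
      simp only [S, ← hP]
      exact integral_norm_pow_four_squares_le l _ hl rfl P a
    refine (integral_Ioi_mul_inv_sq_le (((continuous_S 2 δ X).comp
      (continuous_const.mul continuous_id)).norm.pow 4) (fun x => pow_nonneg (norm_nonneg _) _)
      (one_div_pos.2 hl0) h2 hR1).trans ?_
    refine div_le_div_of_nonneg_right ?_ hR0.le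
    have : 0 ≤ 14 * (X * Real.log X ^ 2) := by positivity
    linarith
  · have h2 : ∀ a, ∫ α in a..a + 1 / |l'|, ‖S k δ X (l' * α)‖ ^ 2 ≤
        1 / |l'| * (7 * X ^ (1 / k) * Real.log X ^ 3) := by
      intro a
      simp only [S]
      refine integral_norm_sq_powers_le k l' _ X hk hl' rfl hX _ (fun p hp => ?_) a
      have := (Finset.mem_filter.1 hp).2
      exact ⟨this.1.one_lt.le, this.2.2⟩
    refine (integral_Ioi_mul_inv_sq_le (((continuous_S k δ X).comp
      (continuous_const.mul continuous_id)).norm.pow 2) (fun x => pow_nonneg (norm_nonneg _) _)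
      (one_div_pos.2 hl'0) h2 hR2).trans ?_
    refine div_le_div_of_nonneg_right ?_ hR0.le
    have : 0 ≤ 2 * C * (X ^ (1 / k) * Real.log X ^ 3) := by positivity
    linarith

end
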